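/- Let ε > 0. There exists a constant C'_ε > 1 such that for all pairwise coprime positive integers a, b, c with a + b = c, the 2-adic valuation satisfies v_2(abc) < C'_ε · rad(abc)^ε. -/

import Mathlib

section

open Module

/-- `f` is approximated modulo `ℓ^g` by an element of `W`. -/
def PApprox {E : Type*} (ℓ g : ℕ) (W : Submodule ℚ (E → ℚ)) (f : E → ℚ) : Prop :=
  ∃ w ∈ W, ∀ x, padicNorm ℓ (f x - w x) ≤ ((ℓ : ℚ) ^ g)⁻¹

lemma rt_core {E ι : Type*} [Fintype E] [Fintype ι] [DecidableEq ι] (ℓ g : ℕ) [hℓ : Fact ℓ.Prime]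
    (W : Submodule ℚ (E → ℚ)) (v : ι → E → ℤ)
    (hv : ∀ i, PApprox ℓ g W (fun x => (v i x : ℚ))) (c : ι → E) :
    padicNorm ℓ ((Matrix.of fun i j => v i (c j)).det : ℤ) ≤
      (((ℓ : ℚ) ^ g)⁻¹) ^ (Fintype.card ι - finrank ℚ W) := by
  choose w hw hwv using hv
  set q : ℚ := ((ℓ : ℚ) ^ g)⁻¹ with hq
  have hl1 : (1 : ℚ) ≤ ℓ := by exact_mod_cast hℓ.out.one_lt.le
  have hq0 : 0 ≤ q := by positivity
  have hq1 : q ≤ 1 := inv_le_one_of_one_le₀ (one_le_pow₀ hl1)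
  have hw1 : ∀ i x, padicNorm ℓ (w i x) ≤ 1 := by
    intro i x
    have : w i x = (v i x : ℚ) - ((v i x : ℚ) - w i x) := by ring
    rw [this]
    refine (padicNorm.sub).trans (max_le (padicNorm.of_int _) ((hwv i x).trans hq1))
  let M1 : ι → ι → ℚ := fun i j => w i (c j)
  let M2 : ι → ι → ℚ := fun i j => (v i (c j) : ℚ) - w i (c j)
  have h1 : (((Matrix.of fun i j => v i (c j)).det : ℤ) : ℚ) =
      Matrix.detRowAlternating (M1 + M2) := by
    rw [Int.cast_det]
    change _ = Matrix.det _
    congr 1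
    ext i j
    simp [M1, M2, Matrix.map]
  rw [h1, AlternatingMap.map_add_univ]
  refine padicNorm.sum_le' (fun s _ => ?_) (by positivity)
  by_cases hs : s.card ≤ finrank ℚ W
  · change padicNorm ℓ (Matrix.det (Matrix.of (s.piecewise M1 M2))) ≤ _
    rw [Matrix.det_apply]
    simp only [Matrix.of_apply]
    refine padicNorm.sum_le' (fun σ _ => ?_) (by positivity)
    have hsg : padicNorm ℓ (Equiv.Perm.sign σ • ∏ i, s.piecewise M1 M2 (σ i) i) =
        padicNorm ℓ (∏ i, s.piecewise M1 M2 (σ i) i) := by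
      rcases Int.units_eq_one_or (Equiv.Perm.sign σ) with h | h <;> rw [h] <;> simp
    rw [hsg]
    have hprod : ∀ t : Finset ι, padicNorm ℓ (∏ i ∈ t, s.piecewise M1 M2 (σ i) i) =
        ∏ i ∈ t, padicNorm ℓ (s.piecewise M1 M2 (σ i) i) := by
      classical
      intro t
      induction t using Finset.induction_on with
      | empty => simp
      | insert a t ha ih => rw [Finset.prod_insert ha, Finset.prod_insert ha, padicNorm.mul, ih]
    rw [hprod]
    calc ∏ i, padicNorm ℓ (s.piecewise M1 M2 (σ i) i)
        ≤ ∏ i, (if σ i ∈ s then 1 else q) := by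
          refine Finset.prod_le_prod (fun i _ => padicNorm.nonneg _) (fun i _ => ?_)
          by_cases hi : σ i ∈ s
          · simp only [Finset.piecewise, hi, if_true]; exact hw1 _ _
          · simp only [Finset.piecewise, hi, if_false]; exact hwv _ _
      _ = ∏ i, (if i ∈ s then 1 else q) := Equiv.prod_comp σ (fun i => if i ∈ s then 1 else q)
      _ = q ^ (Fintype.card ι - s.card) := by
          rw [Finset.prod_ite]
          simp only [Finset.prod_const_one, one_mul, Finset.prod_const]
          congr 1
          rw [← Finset.card_compl]
          congr 1
          ext; simp
      _ ≤ _ := pow_le_pow_of_le_one hq0 hq1 (by omega)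
  · have hz : Matrix.detRowAlternating (s.piecewise M1 M2) = (0 : ℚ) := by
      by_contra hne
      have hli : LinearIndependent ℚ (s.piecewise M1 M2) :=
        Matrix.linearIndependent_rows_of_det_ne_zero (A := Matrix.of (s.piecewise M1 M2)) hne
      have h2 : LinearIndependent ℚ (fun i : s => s.piecewise M1 M2 i) :=
        hli.comp (fun i : s => (i : ι)) Subtype.val_injective
      have h3 : (fun i : s => s.piecewise M1 M2 i) =
          (LinearMap.funLeft ℚ ℚ c) ∘ (fun i : s => w i) := by
        funext i
        rw [Finset.piecewise_eq_of_mem _ _ _ i.2]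
        rfl
      rw [h3] at h2
      have h4 : LinearIndependent ℚ (fun i : s => w i) := LinearIndependent.of_comp _ h2
      have h5 : LinearIndependent ℚ (fun i : s => (⟨w i, hw i⟩ : W)) := by
        apply LinearIndependent.of_comp W.subtype
        exact h4
      have := h5.fintype_card_le_finrank
      simp at this
      exact hs this
    rw [hz]; simp; positivity

lemma rt_core_dvd {E ι : Type*} [Fintype E] [Fintype ι] [DecidableEq ι] (ℓ g : ℕ)
    [hℓ : Fact ℓ.Prime]
    (W : Submodule ℚ (E → ℚ)) (v : ι → E → ℤ)
    (hv : ∀ i, PApprox ℓ g W (fun x => (v i x : ℚ))) (c : ι → E) :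
    ((ℓ ^ (g * (Fintype.card ι - finrank ℚ W)) : ℕ) : ℤ) ∣ (Matrix.of fun i j => v i (c j)).det := by
  rw [padicNorm.dvd_iff_norm_le]
  refine (rt_core ℓ g W v hv c).trans (le_of_eq ?_)
  rw [zpow_neg, zpow_natCast, inv_pow, pow_mul]

lemma rt_two {E : Type*} [Fintype E] [DecidableEq E] (ℓ : ℕ) [hℓ : Fact ℓ.Prime]
    (W : Submodule ℚ (E → ℚ))
    (h : ∀ x0 : E, PApprox ℓ 1 W (fun x => if x = x0 then 1 else 0)) :
    Fintype.card E ≤ finrank ℚ W := by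
  have := rt_core_dvd (ι := E) ℓ 1 W (fun i x => if x = i then 1 else 0)
    (fun i => by simpa using h i) id
  have h1 : (Matrix.of fun i j : E => if (id j) = i then (1 : ℤ) else 0) = 1 := by
    ext i j; simp [Matrix.one_apply, eq_comm]
  rw [h1, Matrix.det_one, one_mul] at this
  by_contra hlt
  push Not at hlt
  have h2 := Int.le_of_dvd one_pos this
  have h3 : 1 < ℓ ^ (Fintype.card E - finrank ℚ W) :=
    Nat.one_lt_pow (by omega) hℓ.out.one_lt
  have : ((1 : ℕ) : ℤ) < (ℓ ^ (Fintype.card E - finrank ℚ W) : ℕ) := by exact_mod_cast h3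
  simp at this h2
  omega

lemma exists_cols {r : ℕ} {E : Type*} [Fintype E] (f : Fin r → E → ℚ)
    (hf : LinearIndependent ℚ f) :
    ∃ c : Fin r → E, (Matrix.of fun i j => f i (c j)).det ≠ 0 := by
  have h1 : (Matrix.of f).rank = r := by
    have := LinearIndependent.rank_matrix (M := Matrix.of f) hf
    simpa using this
  rw [Matrix.rank_eq_finrank_span_cols] at h1
  obtain ⟨g, hg, -, hgi⟩ := Submodule.exists_fun_fin_finrank_span_eq ℚ (Set.range (Matrix.of f).col)
  choose c hc using hg
  let e : Fin r ≃ Fin (finrank ℚ (Submodule.span ℚ (Set.range (Matrix.of f).col))) := finCongr h1.symm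
  refine ⟨c ∘ e, ?_⟩
  have h2 : LinearIndependent ℚ (Matrix.of fun i j => f i ((c ∘ e) j)).col := by
    have h3 : (Matrix.of fun i j => f i ((c ∘ e) j)).col = g ∘ e := by
      funext j
      simp only [Function.comp]
      rw [← hc (e j)]
      rfl
    rw [h3]
    exact hgi.comp e e.injective
  have h4 := Matrix.linearIndependent_cols_iff_isUnit.mp h2
  rw [Matrix.isUnit_iff_isUnit_det] at h4
  exact h4.ne_zero

lemma rt_one {E J : Type*} [Fintype E] (ℓ g H : ℕ) [hℓ : Fact ℓ.Prime]
    (W : Submodule ℚ (E → ℚ)) (v : J → E → ℤ)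
    (hv : ∀ i, PApprox ℓ g W (fun x => (v i x : ℚ))) (hH : 2 ≤ H)
    (hb : ∀ i x, |v i x| ≤ H) (hbig : (Fintype.card E * H) ^ 2 ≤ ℓ ^ g) :
    finrank ℚ (Submodule.span ℚ (Set.range (fun i x => (v i x : ℚ)))) ≤ 2 * finrank ℚ W := by
  set r := finrank ℚ (Submodule.span ℚ (Set.range (fun i x => (v i x : ℚ)))) with hr
  obtain ⟨f, hf, hfi⟩ : ∃ f : Fin r → E → ℚ, (∀ i, f i ∈ Set.range (fun i x => (v i x : ℚ))) ∧
      LinearIndependent ℚ f := by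
    obtain ⟨f, hf, -, hfi⟩ := Submodule.exists_fun_fin_finrank_span_eq ℚ
      (Set.range (fun i x => (v i x : ℚ)))
    exact ⟨f, hf, hfi⟩
  choose t ht using hf
  obtain ⟨c, hc⟩ := exists_cols f hfi
  have hrE : r ≤ Fintype.card E := by
    have := hfi.fintype_card_le_finrank
    simpa using this
  by_contra hlt
  push Not at hlt
  have hdvd := rt_core_dvd ℓ g W (fun i => v (t i)) (fun i => hv (t i)) c
  set D := (Matrix.of fun i j => v (t i) (c j)).det with hD
  have hD0 : D ≠ 0 := by
    intro h0
    apply hc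
    have : (D : ℚ) = (Matrix.of fun i j => f i (c j)).det := by
      rw [hD, Int.cast_det]
      congr 1
      ext i j
      simp [Matrix.map, ← ht i]
    rw [← this, h0]; simp
  have hle : |D| ≤ ((Fintype.card E * H) ^ r : ℕ) := by
    have h1 := Matrix.det_le (A := Matrix.of fun i j => v (t i) (c j))
      (abv := AbsoluteValue.abs) (x := (H : ℤ)) (fun i j => hb _ _)
    simp only [Fintype.card_fin] at h1
    have h2 : |D| ≤ r.factorial • (H : ℤ) ^ r := h1
    refine h2.trans ?_
    rw [nsmul_eq_mul]
    have h3 : r.factorial ≤ (Fintype.card E) ^ r :=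
      (Nat.factorial_le_pow r).trans (Nat.pow_le_pow_left hrE r)
    rw [mul_pow]
    push_cast
    gcongr
    exact_mod_cast h3
  have h5 : ((ℓ ^ (g * (r - finrank ℚ W)) : ℕ) : ℤ) ≤ |D| := by
    have := Int.le_of_dvd (abs_pos.mpr hD0) ((dvd_abs _ _).mpr hdvd)
    simpa using this
  have h6 : ℓ ^ (g * (r - finrank ℚ W)) ≤ (Fintype.card E * H) ^ r := by
    exact_mod_cast h5.trans hle
  have h7 : (Fintype.card E * H) ^ (2 * (r - finrank ℚ W)) ≤ ℓ ^ (g * (r - finrank ℚ W)) := by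
    rw [pow_mul, pow_mul]
    exact Nat.pow_le_pow_left hbig _
  have h8 : 2 ≤ Fintype.card E * H := by
    have : 1 ≤ Fintype.card E := by omega
    nlinarith
  have h9 : (Fintype.card E * H) ^ r < (Fintype.card E * H) ^ (2 * (r - finrank ℚ W)) :=
    Nat.pow_lt_pow_right (by omega) (by omega)
  omega

end

section

open Module Polynomial

lemma padicNorm_prod' {α : Type*} (ℓ : ℕ) [hℓ : Fact ℓ.Prime] (t : Finset α) (f : α → ℚ) :
    padicNorm ℓ (∏ i ∈ t, f i) = ∏ i ∈ t, padicNorm ℓ (f i) := by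
  classical
  induction t using Finset.induction_on with
  | empty => simp
  | insert a t ha ih => rw [Finset.prod_insert ha, Finset.prod_insert ha, padicNorm.mul, ih]

lemma padicNorm_pow' (ℓ : ℕ) [hℓ : Fact ℓ.Prime] (x : ℚ) (k : ℕ) :
    padicNorm ℓ (x ^ k) = padicNorm ℓ x ^ k := by
  induction k with
  | zero => simp
  | succ k ih => rw [pow_succ, pow_succ, padicNorm.mul, ih]

lemma padicNorm_le_of_dvd (ℓ a : ℕ) [hℓ : Fact ℓ.Prime] (z : ℤ) (h : (ℓ : ℤ) ^ a ∣ z) :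
    padicNorm ℓ (z : ℚ) ≤ ((ℓ : ℚ) ^ a)⁻¹ := by
  have := (padicNorm.dvd_iff_norm_le (p := ℓ) (n := a) (z := z)).mp (by exact_mod_cast h)
  rwa [zpow_neg, zpow_natCast] at this

lemma dvd_of_padicNorm_le (ℓ a : ℕ) [hℓ : Fact ℓ.Prime] (z : ℤ)
    (h : padicNorm ℓ (z : ℚ) ≤ ((ℓ : ℚ) ^ a)⁻¹) : (ℓ : ℤ) ^ a ∣ z := by
  have := (padicNorm.dvd_iff_norm_le (p := ℓ) (n := a) (z := z)).mpr
    (by rwa [zpow_neg, zpow_natCast])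
  exact_mod_cast this

/-- lower bound of norm -/
lemma padicNorm_ge_of_not_dvd (ℓ a : ℕ) [hℓ : Fact ℓ.Prime] (z : ℤ) (h : ¬ (ℓ : ℤ) ^ a ∣ z) :
    ((ℓ : ℚ) ^ a)⁻¹ ≤ padicNorm ℓ (z : ℚ) := by
  by_contra hc
  push Not at hc
  exact h (dvd_of_padicNorm_le ℓ a z hc.le)

lemma not_pow_dvd_of_small (ℓ a : ℕ) (hℓ : 2 ≤ ℓ) (z : ℤ) (hz : z ≠ 0) (h : |z| ≤ a) :
    ¬ (ℓ : ℤ) ^ a ∣ z := by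
  intro hd
  have h1 := Int.le_of_dvd (abs_pos.mpr hz) ((dvd_abs _ _).mpr hd)
  have h2 : a < ℓ ^ a := Nat.lt_pow_self (by omega)
  have : (a : ℤ) < (ℓ : ℤ) ^ a := by exact_mod_cast h2
  omega

lemma padicNorm_factorial_ge (ℓ k : ℕ) [hℓ : Fact ℓ.Prime] :
    ((ℓ : ℚ) ^ k)⁻¹ ≤ padicNorm ℓ (k.factorial : ℚ) := by
  have h0 : (k.factorial : ℚ) ≠ 0 := by exact_mod_cast k.factorial_ne_zero
  rw [padicNorm.eq_zpow_of_nonzero h0]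
  rw [← zpow_natCast, ← zpow_neg]
  have h1 : (1 : ℚ) ≤ ℓ := by exact_mod_cast hℓ.out.one_lt.le
  apply zpow_le_zpow_right₀ h1
  have := sub_one_mul_padicValNat_factorial (p := ℓ) k
  have h2 : padicValNat ℓ k.factorial ≤ k := by
    have h3 : 1 ≤ ℓ - 1 := by have := hℓ.out.two_le; omega
    nlinarith [Nat.sub_le k (ℓ.digits k).sum]
  have h4 : padicValRat ℓ (k.factorial : ℚ) = (padicValNat ℓ k.factorial : ℤ) := by simp
  rw [h4]
  omega

/-- interpolation of integer polynomials has integer remainder -/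
lemma interp_int {ι : Type*} [Fintype ι] [DecidableEq ι] (ν : ι → ℕ) (hν : Function.Injective ν)
    (G : ℤ[X]) (t : ℕ) :
    ∃ z : ℤ, ((G.eval (t : ℤ) : ℤ) : ℚ) - ∑ i, (Lagrange.basis Finset.univ (fun i => (ν i : ℚ)) i).eval (t : ℚ) *
      ((G.eval (ν i : ℤ) : ℤ) : ℚ) = z ∧ (G.natDegree < Fintype.card ι → z = 0) := by
  classical
  have hinj : Set.InjOn (fun i => (ν i : ℚ)) (Finset.univ : Finset ι) := by
    intro a _ b _ h; exact hν (by simpa using h)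
  have key : ∀ R : ℤ[X], R.degree < (Fintype.card ι : ℕ) → (∀ i, R.eval (ν i : ℤ) = G.eval (ν i : ℤ)) →
      ∑ i, (Lagrange.basis Finset.univ (fun i => (ν i : ℚ)) i).eval (t : ℚ) *
      ((G.eval (ν i : ℤ) : ℤ) : ℚ) = ((R.eval (t : ℤ) : ℤ) : ℚ) := by
    intro R hR hRG
    have h1 : R.map (Int.castRingHom ℚ) = Lagrange.interpolate Finset.univ (fun i => (ν i : ℚ))
        (fun i => ((G.eval (ν i : ℤ) : ℤ) : ℚ)) := by
      apply Lagrange.eq_interpolate_of_eval_eq _ hinj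
      · refine (degree_map_le).trans_lt ?_
        exact hR
      · intro i _
        rw [← hRG i]
        simp
    have h2 := congrArg (fun P => P.eval (t : ℚ)) h1
    simp only [Lagrange.interpolate_apply, Polynomial.eval_finsetSum, eval_mul, eval_C] at h2
    have h3 := Polynomial.eval_intCast_map (Int.castRingHom ℚ) R (t : ℤ)
    simp only [Int.cast_natCast, eq_intCast] at h3
    rw [← h3, h2]
    exact Finset.sum_congr rfl (fun i _ => mul_comm _ _)
  by_cases hG : G.natDegree < Fintype.card ι
  · refine ⟨0, ?_, fun _ => rfl⟩
    rw [key G ((degree_le_natDegree).trans_lt (by exact_mod_cast hG)) (fun _ => rfl)]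
    simp
  · let Ω : ℤ[X] := ∏ i, (X - C (ν i : ℤ))
    have hΩ : Ω.Monic := monic_prod_of_monic _ _ (fun i _ => monic_X_sub_C _)
    have hdeg : Ω.degree = (Fintype.card ι : ℕ) := by
      simp only [Ω, degree_prod, degree_X_sub_C]; simp
    refine ⟨G.eval (t : ℤ) - (G %ₘ Ω).eval (t : ℤ), ?_, fun h => absurd h hG⟩
    rw [key (G %ₘ Ω) (by rw [← hdeg]; exact degree_modByMonic_lt _ hΩ)]
    · push_cast; ring
    · intro i
      have h1 := modByMonic_add_div G Ω
      have h2 : Ω.eval (ν i : ℤ) = 0 := by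
        simp only [Ω, eval_prod]
        exact Finset.prod_eq_zero (Finset.mem_univ i) (by simp)
      have h3 := congrArg (fun P => P.eval (ν i : ℤ)) h1
      simp only [eval_add, eval_mul, h2, zero_mul, add_zero] at h3
      exact h3

lemma interp_pow {ι : Type*} [Fintype ι] [DecidableEq ι] (ν : ι → ℕ) (hν : Function.Injective ν)
    (ℓ m : ℕ) [hℓ : Fact ℓ.Prime] (β : ℤ) (hβ : (ℓ : ℤ) ^ (m + 2) ∣ β) (U t : ℕ) :
    padicNorm ℓ (((1 + β : ℤ) : ℚ) ^ (t * U) -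
      ∑ i, (Lagrange.basis Finset.univ (fun i => (ν i : ℚ)) i).eval (t : ℚ) *
        ((1 + β : ℤ) : ℚ) ^ (ν i * U)) ≤ ((ℓ : ℚ) ^ ((m + 1) * Fintype.card ι))⁻¹ := by
  classical
  let G : ℕ → ℤ[X] := fun k => (descPochhammer ℤ k).comp (C (U : ℤ) * X)
  have hG : ∀ k z : ℕ, (G k).eval (z : ℤ) = (k.factorial * (z * U).choose k : ℕ) := by
    intro k z
    simp only [G, eval_comp, eval_mul, eval_C, eval_X]
    rw [show (U : ℤ) * z = ((z * U : ℕ) : ℤ) by push_cast; ring]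
    rw [descPochhammer_eval_eq_descFactorial, Nat.descFactorial_eq_factorial_mul_choose]
  have hGdeg : ∀ k, (G k).natDegree ≤ k := by
    intro k
    refine (natDegree_comp_le).trans ?_
    rw [descPochhammer_natDegree]
    calc k * (C (U : ℤ) * X).natDegree ≤ k * 1 := Nat.mul_le_mul_left _ ((natDegree_C_mul_le _ _).trans natDegree_X_le)
      _ = k := mul_one k
  obtain ⟨K, hK⟩ : ∃ K, t * U < K ∧ ∀ i, ν i * U < K := by
    refine ⟨t * U + ∑ i, ν i * U + 1, by omega, fun i => ?_⟩
    have := Finset.single_le_sum (f := fun i => ν i * U) (fun _ _ => Nat.zero_le _) (Finset.mem_univ i)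
    omega
  have hexp : ∀ z : ℕ, z * U < K → ((1 + β : ℤ) : ℚ) ^ (z * U) =
      ∑ k ∈ Finset.range K, ((β : ℚ) ^ k / k.factorial) * (((G k).eval (z : ℤ) : ℤ) : ℚ) := by
    intro z hz
    push_cast
    rw [add_comm, add_pow]
    rw [← Finset.sum_subset (Finset.range_mono (show z * U + 1 ≤ K by omega))]
    · refine Finset.sum_congr rfl (fun k _ => ?_)
      rw [hG]
      have : (k.factorial : ℚ) ≠ 0 := by exact_mod_cast k.factorial_ne_zero
      push_cast
      field_simp
      simp
    · intro k _ hk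
      have : (z * U).choose k = 0 := Nat.choose_eq_zero_of_lt (by simp at hk; omega)
      rw [hG, this]; simp
  rw [hexp t hK.1]
  have : ∑ i, (Lagrange.basis Finset.univ (fun i => (ν i : ℚ)) i).eval (t : ℚ) *
        ((1 + β : ℤ) : ℚ) ^ (ν i * U) = ∑ k ∈ Finset.range K, ((β : ℚ) ^ k / k.factorial) *
        ∑ i, (Lagrange.basis Finset.univ (fun i => (ν i : ℚ)) i).eval (t : ℚ) *
        (((G k).eval (ν i : ℤ) : ℤ) : ℚ) := by
    simp_rw [Finset.mul_sum]
    rw [Finset.sum_comm]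
    refine Finset.sum_congr rfl (fun i _ => ?_)
    rw [hexp _ (hK.2 i), Finset.mul_sum]
    refine Finset.sum_congr rfl (fun k _ => by ring)
  rw [this, ← Finset.sum_sub_distrib]
  refine padicNorm.sum_le' (fun k _ => ?_) (by positivity)
  rw [← mul_sub]
  obtain ⟨z, hz, hz0⟩ := interp_int ν hν (G k) t
  rw [hz]
  by_cases hk : k < Fintype.card ι
  · rw [hz0 ((hGdeg k).trans_lt hk)]
    simp
  · push Not at hk
    rw [padicNorm.mul, padicNorm.div, padicNorm_pow']
    have h1 : padicNorm ℓ (β : ℚ) ≤ ((ℓ : ℚ) ^ (m + 2))⁻¹ := padicNorm_le_of_dvd _ _ _ hβ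
    have h2 := padicNorm_factorial_ge ℓ k
    have hl : (1 : ℚ) ≤ ℓ := by exact_mod_cast hℓ.out.one_lt.le
    have hl0 : (0 : ℚ) < ℓ := by linarith
    calc padicNorm ℓ (β : ℚ) ^ k / padicNorm ℓ (k.factorial : ℚ) * padicNorm ℓ (z : ℚ)
        ≤ (((ℓ : ℚ) ^ (m + 2))⁻¹) ^ k / ((ℓ : ℚ) ^ k)⁻¹ * 1 := by
          apply mul_le_mul _ (padicNorm.of_int _) (padicNorm.nonneg _) (by positivity)
          apply div_le_div₀ (by positivity) _ (by positivity) h2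
          exact pow_le_pow_left₀ (padicNorm.nonneg _) h1 k
      _ = ((ℓ : ℚ) ^ ((m + 1) * k))⁻¹ := by
          rw [mul_one, div_inv_eq_mul, inv_pow, ← pow_mul, show (m + 2) * k = (m + 1) * k + k by ring,
            pow_add]
          field_simp
      _ ≤ _ := by
          apply inv_anti₀ (by positivity)
          exact pow_le_pow_right₀ hl (Nat.mul_le_mul_left _ hk)

end

section

open Module Polynomial

lemma lagrange_bound (ℓ w S h : ℕ) [hℓ : Fact ℓ.Prime] (hSw : S ≤ w) (p : Fin S × Fin h) (t : ℕ) :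
    padicNorm ℓ ((Lagrange.basis Finset.univ
      (fun q : Fin S × Fin h => ((q.1 + ℓ ^ w * q.2 : ℕ) : ℚ)) p).eval (t : ℚ)) ≤
      (ℓ : ℚ) ^ ((h - 1) * (w + h) + h * S * S) := by
  have hl : (1 : ℚ) ≤ ℓ := by exact_mod_cast hℓ.out.one_lt.le
  have hl0 : (0 : ℚ) < ℓ := by linarith
  have hl2 := hℓ.out.two_le
  rw [Lagrange.basis, eval_prod, padicNorm_prod']
  set f : Fin S × Fin h → ℚ := fun q => if q.1 = p.1 then (ℓ : ℚ) ^ (w + h) else (ℓ : ℚ) ^ S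
  calc _ ≤ ∏ q ∈ Finset.univ.erase p, f q := by
        refine Finset.prod_le_prod (fun _ _ => padicNorm.nonneg _) (fun q hq => ?_)
        have hqp : q ≠ p := Finset.ne_of_mem_erase hq
        simp only [Lagrange.basisDivisor, eval_mul, eval_C, eval_sub, eval_X]
        set D : ℤ := ((p.1 + ℓ ^ w * p.2 : ℕ) : ℤ) - ((q.1 + ℓ ^ w * q.2 : ℕ) : ℤ) with hD
        have e1 : (((p.1 + ℓ ^ w * p.2 : ℕ) : ℚ) - ((q.1 + ℓ ^ w * q.2 : ℕ) : ℚ)) = (D : ℚ) := by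
          rw [hD]; push_cast; ring
        have e2 : ((t : ℚ) - ((q.1 + ℓ ^ w * q.2 : ℕ) : ℚ)) =
            (((t : ℤ) - ((q.1 + ℓ ^ w * q.2 : ℕ) : ℤ) : ℤ) : ℚ) := by push_cast; ring
        rw [e1, e2, padicNorm.mul]
        have main : (f q)⁻¹ ≤ padicNorm ℓ (D : ℚ) := by
          by_cases hs : q.1 = p.1
          · simp only [f, hs, if_true]
            have hi : q.2 ≠ p.2 := fun h => hqp (Prod.ext hs h)
            have hD2 : D = (ℓ : ℤ) ^ w * ((p.2 : ℤ) - (q.2 : ℤ)) := by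
              rw [hD, hs]; push_cast; ring
            apply padicNorm_ge_of_not_dvd
            rw [hD2, pow_add]
            intro hd
            have := Int.dvd_of_mul_dvd_mul_left (by positivity) hd
            revert this
            apply not_pow_dvd_of_small _ _ hl2
            · intro h0; apply hi; ext; omega
            · have := p.2.2; have := q.2.2; rw [abs_le]; omega
          · simp only [f, hs, if_false]
            apply padicNorm_ge_of_not_dvd
            intro hd
            have h3 : (ℓ : ℤ) ^ S ∣ (p.1 : ℤ) - (q.1 : ℤ) := by
              have h4 : (ℓ : ℤ) ^ S ∣ (ℓ : ℤ) ^ w * ((p.2 : ℤ) - (q.2 : ℤ)) :=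
                (pow_dvd_pow _ hSw).mul_right _
              have h5 := dvd_sub hd h4
              have h6 : D - (ℓ : ℤ) ^ w * ((p.2 : ℤ) - (q.2 : ℤ)) = (p.1 : ℤ) - (q.1 : ℤ) := by
                rw [hD]; push_cast; ring
              rwa [h6] at h5
            revert h3
            apply not_pow_dvd_of_small _ _ hl2
            · intro h0; apply hs; ext; omega
            · have := p.1.2; have := q.1.2; rw [abs_le]; omega
        have hf : 0 < f q := by simp only [f]; split_ifs <;> positivity
        have h7 : padicNorm ℓ ((D : ℚ)⁻¹) ≤ f q := by
          rw [← one_div, padicNorm.div, padicNorm.one, one_div]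
          exact inv_le_of_inv_le₀ hf main
        calc _ ≤ f q * 1 := mul_le_mul h7 (padicNorm.of_int _) (padicNorm.nonneg _) hf.le
          _ = f q := mul_one _
    _ = ((ℓ : ℚ) ^ (w + h)) ^ ((Finset.univ.erase p).filter (fun q => q.1 = p.1)).card *
          ((ℓ : ℚ) ^ S) ^ ((Finset.univ.erase p).filter (fun q => ¬ q.1 = p.1)).card := by
        simp only [f]
        rw [Finset.prod_ite, Finset.prod_const, Finset.prod_const]
    _ ≤ _ := by
        rw [← pow_mul, ← pow_mul, ← pow_add]
        apply pow_le_pow_right₀ hl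
        have c1 : ((Finset.univ.erase p).filter (fun q => q.1 = p.1)).card ≤ h - 1 := by
          have : ((Finset.univ.erase p).filter (fun q => q.1 = p.1)).card ≤
              ((Finset.univ : Finset (Fin h)).erase p.2).card := by
            apply Finset.card_le_card_of_injOn (fun q => q.2)
            · intro q hq
              simp only [Finset.coe_filter, Finset.mem_erase, Finset.mem_univ, and_true, Set.mem_setOf_eq] at hq
              simp only [Finset.coe_erase, Finset.coe_univ, Set.mem_diff, Set.mem_univ, true_and, Set.mem_singleton_iff]
              intro h0; exact hq.1 (Prod.ext hq.2 h0)
            · intro q hq q' hq' h0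
              simp only [Finset.coe_filter, Finset.mem_erase, Finset.mem_univ, and_true, Set.mem_setOf_eq] at hq hq'
              exact Prod.ext (hq.2.trans hq'.2.symm) h0
          rwa [Finset.card_erase_of_mem (Finset.mem_univ _), Finset.card_univ, Fintype.card_fin] at this
        have c2 : ((Finset.univ.erase p).filter (fun q => ¬ q.1 = p.1)).card ≤ h * S := by
          refine (Finset.card_le_univ _).trans (le_of_eq ?_)
          simp [mul_comm]
        calc _ ≤ (w + h) * (h - 1) + S * (h * S) :=
              Nat.add_le_add (Nat.mul_le_mul_left _ c1) (Nat.mul_le_mul_left _ c2)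
          _ = _ := by ring

/-- `(1+β)^N` truncated binomial -/
lemma trunc_binom (β : ℤ) (N h : ℕ) :
    β ^ h ∣ (1 + β) ^ N - ∑ j ∈ Finset.range h, (N.choose j : ℤ) * β ^ j := by
  rw [add_comm, add_pow]
  have h1 : ∑ j ∈ Finset.range (N + 1), β ^ j * 1 ^ (N - j) * (N.choose j : ℤ) =
      ∑ j ∈ Finset.range (N + 1 + h), β ^ j * 1 ^ (N - j) * (N.choose j : ℤ) := by
    apply Finset.sum_subset (Finset.range_mono (by omega))
    intro k _ hk
    rw [Nat.choose_eq_zero_of_lt (by simp at hk; omega)]; simp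
  rw [h1, add_comm (N + 1) h, Finset.sum_range_add]
  have h2 : ∑ j ∈ Finset.range h, β ^ j * 1 ^ (N - j) * (N.choose j : ℤ) =
      ∑ j ∈ Finset.range h, (N.choose j : ℤ) * β ^ j :=
    Finset.sum_congr rfl (fun j _ => by simp [mul_comm])
  rw [h2, add_sub_cancel_left]
  refine Finset.dvd_sum (fun j _ => ?_)
  rw [pow_add]
  exact ((dvd_mul_right _ _).mul_right _).mul_right _

lemma interp_main (ℓ m w S h g V : ℕ) [hℓ : Fact ℓ.Prime] (hh : 1 ≤ h)
    (hg : g = (m + 1) * (S * h)) (hw : g + h * h + h * S * S + S ≤ w) (hV : h * (w + 1) ≤ V)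
    (B0 c : ℤ) (hB0 : (ℓ : ℤ) ^ (m + 2) ∣ B0 - 1) (hc : ¬ (ℓ : ℤ) ∣ c) (t : ℕ) :
    ∃ K : Fin S → Fin h → Fin h → ℚ, ∀ (U : ℕ) (Y : ℤ), (ℓ : ℤ) ^ V ∣ Y - c * B0 ^ U →
      padicNorm ℓ ((Y : ℚ) ^ t - ∑ s : Fin S, ∑ i : Fin h, ∑ j : Fin h,
        K s i j * (((i * U : ℕ).choose j : ℕ) : ℚ) * (Y : ℚ) ^ (s : ℕ)) ≤ ((ℓ : ℚ) ^ g)⁻¹ := by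
  have hl : (1 : ℚ) ≤ ℓ := by exact_mod_cast hℓ.out.one_lt.le
  have hl0 : (0 : ℚ) < ℓ := by linarith
  set ν : Fin S × Fin h → ℕ := fun q => q.1 + ℓ ^ w * q.2 with hνdef
  have hν : Function.Injective ν := by
    intro p q hpq
    simp only [hνdef] at hpq
    have hS : S < ℓ ^ w := lt_of_le_of_lt (by omega) (Nat.lt_pow_self hℓ.out.one_lt)
    have h1 := p.1.2; have h2 := q.1.2
    have e1 : (p.1 : ℕ) = q.1 := by
      have := congrArg (fun x => x % ℓ ^ w) hpq
      simp only [Nat.add_mul_mod_self_left] at this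
      rwa [Nat.mod_eq_of_lt (by omega), Nat.mod_eq_of_lt (by omega)] at this
    have e2 : (p.2 : ℕ) = q.2 := by
      rw [e1] at hpq
      have := Nat.add_left_cancel hpq
      exact Nat.eq_of_mul_eq_mul_left (by omega) this
    exact Prod.ext (Fin.ext e1) (Fin.ext e2)
  set β' : ℤ := B0 ^ (ℓ ^ w) - 1 with hβ'
  have hβ'd : (ℓ : ℤ) ^ (w + 1) ∣ β' := by
    have h1 : (ℓ : ℤ) ∣ B0 - 1 := (dvd_pow_self _ (by omega)).trans hB0
    have := dvd_sub_pow_of_dvd_sub h1 w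
    simpa using this
  let Lg : Fin S × Fin h → ℚ := fun q =>
    (Lagrange.basis Finset.univ (fun q : Fin S × Fin h => (ν q : ℚ)) q).eval (t : ℚ)
  have hLg : ∀ q, padicNorm ℓ (Lg q) ≤ (ℓ : ℚ) ^ ((h - 1) * (w + h) + h * S * S) :=
    fun q => lagrange_bound ℓ w S h (by omega) q t
  have hcn : padicNorm ℓ (c : ℚ) = 1 := (padicNorm.int_eq_one_iff c).mpr hc
  have hc0 : (c : ℚ) ≠ 0 := by
    intro h0; rw [h0] at hcn; simp at hcn
  refine ⟨fun s i j => Lg (s, i) * ((c : ℚ) ^ t / (c : ℚ) ^ (s : ℕ)) * (β' : ℚ) ^ (j : ℕ), ?_⟩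
  intro U Y hY
  let Pz : Fin h → ℤ := fun i => ∑ j ∈ Finset.range h, ((i * U : ℕ).choose j : ℤ) * β' ^ j
  have hsum : ∑ s : Fin S, ∑ i : Fin h, ∑ j : Fin h,
        (Lg (s, i) * ((c : ℚ) ^ t / (c : ℚ) ^ (s : ℕ)) * (β' : ℚ) ^ (j : ℕ)) *
          (((i * U : ℕ).choose j : ℕ) : ℚ) * (Y : ℚ) ^ (s : ℕ) =
      ∑ q : Fin S × Fin h, Lg q * ((c : ℚ) ^ t / (c : ℚ) ^ (q.1 : ℕ)) * ((Y ^ (q.1 : ℕ) * Pz q.2 : ℤ) : ℚ) := by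
    rw [Fintype.sum_prod_type]
    refine Finset.sum_congr rfl (fun s _ => Finset.sum_congr rfl (fun i _ => ?_))
    simp only [Pz]
    push_cast
    rw [Finset.sum_range, Finset.mul_sum, Finset.mul_sum]
    refine Finset.sum_congr rfl (fun j _ => by ring)
  rw [hsum]
  have hYs : ∀ s : ℕ, (ℓ : ℤ) ^ V ∣ Y ^ s - c ^ s * B0 ^ (s * U) := by
    intro s
    have := hY.trans (sub_dvd_pow_sub_pow Y (c * B0 ^ U) s)
    rwa [mul_pow, ← pow_mul, mul_comm U s] at this
  have hdec : (Y : ℚ) ^ t - ∑ q : Fin S × Fin h, Lg q * ((c : ℚ) ^ t / (c : ℚ) ^ (q.1 : ℕ)) *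
        ((Y ^ (q.1 : ℕ) * Pz q.2 : ℤ) : ℚ) =
      ((Y ^ t - c ^ t * B0 ^ (t * U) : ℤ) : ℚ) +
      (c : ℚ) ^ t * (((1 + (B0 - 1) : ℤ) : ℚ) ^ (t * U) - ∑ q, Lg q * ((1 + (B0 - 1) : ℤ) : ℚ) ^ (ν q * U)) +
      ∑ q : Fin S × Fin h, Lg q * ((c : ℚ) ^ t / (c : ℚ) ^ (q.1 : ℕ)) *
        ((c ^ (q.1 : ℕ) * B0 ^ (ν q * U) - Y ^ (q.1 : ℕ) * Pz q.2 : ℤ) : ℚ) := by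
    have e : ∑ q : Fin S × Fin h, Lg q * ((c : ℚ) ^ t / (c : ℚ) ^ (q.1 : ℕ)) *
        ((c ^ (q.1 : ℕ) * B0 ^ (ν q * U) - Y ^ (q.1 : ℕ) * Pz q.2 : ℤ) : ℚ) =
        (c : ℚ) ^ t * ∑ q, Lg q * ((1 + (B0 - 1) : ℤ) : ℚ) ^ (ν q * U) -
        ∑ q : Fin S × Fin h, Lg q * ((c : ℚ) ^ t / (c : ℚ) ^ (q.1 : ℕ)) *
        ((Y ^ (q.1 : ℕ) * Pz q.2 : ℤ) : ℚ) := by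
      rw [Finset.mul_sum, ← Finset.sum_sub_distrib]
      refine Finset.sum_congr rfl (fun q _ => ?_)
      have : (c : ℚ) ^ (q.1 : ℕ) ≠ 0 := pow_ne_zero _ hc0
      push_cast
      rw [add_sub_cancel]
      field_simp
    rw [e]
    push_cast
    ring
  rw [hdec]
  have hgV : g ≤ V := by
    have : 1 * (w + 1) ≤ h * (w + 1) := Nat.mul_le_mul_right _ hh
    omega
  refine (padicNorm.nonarchimedean).trans (max_le ((padicNorm.nonarchimedean).trans (max_le ?_ ?_)) ?_)
  · refine (padicNorm_le_of_dvd _ _ _ (hYs t)).trans ?_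
    exact inv_anti₀ (by positivity) (pow_le_pow_right₀ hl hgV)
  · rw [padicNorm.mul, padicNorm_pow', hcn, one_pow, one_mul]
    refine (interp_pow ν hν ℓ m (B0 - 1) hB0 U t).trans (le_of_eq ?_)
    rw [hg]; simp
  · refine padicNorm.sum_le' (fun q _ => ?_) (by positivity)
    rw [padicNorm.mul, padicNorm.mul, padicNorm.div, padicNorm_pow', padicNorm_pow', hcn, one_pow,
      one_pow, div_one, mul_one]
    have hd : (ℓ : ℤ) ^ (h * (w + 1)) ∣ c ^ (q.1 : ℕ) * B0 ^ (ν q * U) - Y ^ (q.1 : ℕ) * Pz q.2 := by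
      have e : c ^ (q.1 : ℕ) * B0 ^ (ν q * U) - Y ^ (q.1 : ℕ) * Pz q.2 =
          c ^ (q.1 : ℕ) * B0 ^ (q.1 * U) * ((1 + β') ^ (q.2 * U : ℕ) - Pz q.2) -
          (Y ^ (q.1 : ℕ) - c ^ (q.1 : ℕ) * B0 ^ (q.1 * U)) * Pz q.2 := by
        have : B0 ^ (ν q * U) = B0 ^ (q.1 * U) * (1 + β') ^ (q.2 * U : ℕ) := by
          rw [hβ', add_sub_cancel, ← pow_mul, ← pow_add]
          congr 1
          simp only [hνdef]; ring
        rw [this]; ring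
      rw [e]
      refine dvd_sub (Dvd.dvd.mul_left ?_ _) (((pow_dvd_pow _ hV).trans (hYs _)).mul_right _)
      refine dvd_trans ?_ (trunc_binom β' (q.2 * U) h)
      rw [mul_comm, pow_mul]
      exact pow_dvd_pow_of_dvd hβ'd h
    calc _ ≤ (ℓ : ℚ) ^ ((h - 1) * (w + h) + h * S * S) * ((ℓ : ℚ) ^ (h * (w + 1)))⁻¹ :=
          mul_le_mul (hLg q) (padicNorm_le_of_dvd _ _ _ hd) (padicNorm.nonneg _) (by positivity)
      _ ≤ _ := by
          rw [← div_eq_mul_inv, div_le_iff₀ (by positivity), inv_mul_eq_div, le_div_iff₀ (by positivity),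
            ← pow_add]
          apply pow_le_pow_right₀ hl
          obtain ⟨h', rfl⟩ : ∃ h', h = h' + 1 := ⟨h - 1, by omega⟩
          simp only [Nat.add_sub_cancel]
          nlinarith

end

section

open Module

/-- index set of monomials `X^τ Y^s` -/
def MonIdx (κ : Type*) [Fintype κ] (T S : ℕ) : Type _ :=
  {p : (κ → ℕ) × ℕ // ∑ i, p.1 i ≤ T ∧ p.2 < S}

/-- monomial functions -/
def monFun {E κ : Type*} [Fintype κ] (X : E → κ → ℤ) (Y : E → ℤ) (T S : ℕ) :
    MonIdx κ T S → E → ℤ :=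
  fun p x => (∏ i, X x i ^ p.1.1 i) * Y x ^ p.1.2

/-- space of polynomial functions -/
def VS {E κ : Type*} [Fintype κ] (X : E → κ → ℤ) (Y : E → ℤ) (T S : ℕ) : Submodule ℚ (E → ℚ) :=
  Submodule.span ℚ (Set.range (fun p x => (monFun X Y T S p x : ℚ)))

section
variable {E κ : Type*} [Fintype κ] (X : E → κ → ℤ) (Y : E → ℤ)

lemma VS_mono {T T' S S' : ℕ} (hT : T ≤ T') (hS : S ≤ S') : VS X Y T S ≤ VS X Y T' S' := by
  apply Submodule.span_mono
  rintro _ ⟨⟨p, hp⟩, rfl⟩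
  exact ⟨⟨p, hp.1.trans hT, hp.2.trans_le hS⟩, rfl⟩

lemma mon_mem_VS (T S : ℕ) (τ : κ → ℕ) (s : ℕ) (hτ : ∑ i, τ i ≤ T) (hs : s < S) :
    (fun x => ((∏ i, (X x i : ℚ) ^ τ i) * (Y x : ℚ) ^ s)) ∈ VS X Y T S := by
  refine Submodule.subset_span ⟨⟨(τ, s), hτ, hs⟩, ?_⟩
  funext x
  simp [monFun]

lemma VS_mul_X {T S : ℕ} (i : κ) {f : E → ℚ} (hf : f ∈ VS X Y T S) :
    (fun x => (X x i : ℚ) * f x) ∈ VS X Y (T + 1) S := by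
  classical
  induction hf using Submodule.span_induction with
  | mem f hf =>
    obtain ⟨⟨⟨τ, s⟩, h1, h2⟩, rfl⟩ := hf
    have := mon_mem_VS X Y (T + 1) S (τ + Pi.single i 1) s
      (by simp only [Pi.add_apply, Finset.sum_add_distrib, Finset.sum_pi_single', Finset.mem_univ,
            if_true]; simpa using h1) h2
    convert this using 1
    funext x
    simp only [monFun, Pi.add_apply, pow_add, Finset.prod_mul_distrib]
    have e : ∏ j, (X x j : ℚ) ^ (Pi.single i 1 : κ → ℕ) j = X x i := by
      rw [Finset.prod_eq_single i]
      · simp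
      · intro b _ hb; simp [Pi.single_eq_of_ne hb]
      · simp
    rw [e]
    push_cast
    ring
  | zero => 
    have := (VS X Y (T + 1) S).zero_mem
    convert this using 1
    funext x
    simp
  | add f g _ _ hf hg =>
    have := Submodule.add_mem _ hf hg
    convert this using 1
    funext x
    simp [mul_add]
  | smul a f _ hf =>
    have := Submodule.smul_mem _ a hf
    convert this using 1
    funext x
    simp; ring

lemma VS_mul_affine {T S : ℕ} (u0 : ℚ) (u : κ → ℚ) (U : E → ℚ)
    (hU : ∀ x, U x = u0 + ∑ i, u i * X x i) {f : E → ℚ} (hf : f ∈ VS X Y T S) :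
    (fun x => U x * f x) ∈ VS X Y (T + 1) S := by
  have : (fun x => U x * f x) = u0 • f + ∑ i, u i • (fun x => (X x i : ℚ) * f x) := by
    funext x
    simp only [hU, Pi.add_apply, Pi.smul_apply, smul_eq_mul, Finset.sum_apply, add_mul,
      Finset.sum_mul]
    congr 1
    exact Finset.sum_congr rfl (fun i _ => by ring)
  rw [this]
  refine Submodule.add_mem _ (Submodule.smul_mem _ _ (VS_mono X Y (by omega) le_rfl hf)) ?_
  exact Submodule.sum_mem _ (fun i _ => Submodule.smul_mem _ _ (VS_mul_X X Y i hf))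

lemma VS_mul_choose {T S : ℕ} (u0 : ℚ) (u : κ → ℚ) (U : E → ℕ)
    (hU : ∀ x, (U x : ℚ) = u0 + ∑ i, u i * X x i) {f : E → ℚ} (hf : f ∈ VS X Y T S) (i j : ℕ) :
    (fun x => (((i * U x).choose j : ℕ) : ℚ) * f x) ∈ VS X Y (T + j) S := by
  induction j with
  | zero => simpa using hf
  | succ j ih =>
    have h1 := VS_mul_affine X Y ((i * u0 - j) / (j + 1)) (fun k => i * u k / (j + 1))
      (fun x => (i * U x - j) / (j + 1)) (fun x => by
        rw [hU x, mul_add, Finset.mul_sum]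
        rw [show (i * u0 + ∑ k, (i : ℚ) * (u k * X x k) - j) / ((j : ℚ) + 1) =
          (i * u0 - j) / (j + 1) + (∑ k, (i : ℚ) * (u k * X x k)) / (j + 1) by ring]
        rw [Finset.sum_div]
        congr 1
        exact Finset.sum_congr rfl (fun k _ => by ring)) ih
    rw [← add_assoc]
    convert h1 using 1
    funext x
    have h2 := Nat.choose_succ_right_eq (i * U x) j
    have h3 : (((i * U x).choose (j + 1) : ℕ) : ℚ) * (j + 1) =
        (((i * U x).choose j : ℕ) : ℚ) * (i * U x - j) := by
      by_cases hlt : j ≤ i * U x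
      · have : (((i * U x).choose (j + 1) * (j + 1) : ℕ) : ℚ) =
          (((i * U x).choose j * (i * U x - j) : ℕ) : ℚ) := by rw [h2]
        push_cast [Nat.cast_sub hlt] at this
        exact this
      · rw [Nat.choose_eq_zero_of_lt (show i * U x < j + 1 by omega),
          Nat.choose_eq_zero_of_lt (show i * U x < j by omega)]
        simp
    have h4 : ((j : ℚ) + 1) ≠ 0 := by positivity
    have h5 : (((i * U x).choose (j + 1) : ℕ) : ℚ) =
        (((i * U x).choose j : ℕ) : ℚ) * (i * U x - j) / (j + 1) := by
      rw [eq_div_iff h4, h3]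
    rw [h5]; ring

lemma chain_step [Fintype E] (ℓ m w S h g V T' S' H : ℕ) [hℓ : Fact ℓ.Prime] (hh : 1 ≤ h)
    (hg : g = (m + 1) * (S * h)) (hw : g + h * h + h * S * S + S ≤ w) (hV : h * (w + 1) ≤ V)
    (B0 c : ℤ) (hB0 : (ℓ : ℤ) ^ (m + 2) ∣ B0 - 1) (hc : ¬ (ℓ : ℤ) ∣ c)
    (u0 : ℚ) (u : κ → ℚ) (U : E → ℕ)
    (hU : ∀ x, (U x : ℚ) = u0 + ∑ i, u i * X x i)
    (hY : ∀ x, (ℓ : ℤ) ^ V ∣ Y x - c * B0 ^ (U x))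
    (hH : 2 ≤ H) (hb : ∀ p x, |monFun X Y T' S' p x| ≤ H)
    (hbig : (Fintype.card E * H) ^ 2 ≤ ℓ ^ g) :
    finrank ℚ (VS X Y T' S') ≤ 2 * finrank ℚ (VS X Y (T' + h) S) := by
  refine rt_one ℓ g H (VS X Y (T' + h) S) (monFun X Y T' S') ?_ hH hb hbig
  rintro ⟨⟨τ, t⟩, hτ, ht⟩
  obtain ⟨K, hK⟩ := interp_main ℓ m w S h g V hh hg hw hV B0 c hB0 hc t
  refine ⟨fun x => ∑ s : Fin S, ∑ i : Fin h, ∑ j : Fin h,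
    K s i j * ((((i * U x : ℕ).choose j : ℕ) : ℚ) * ((∏ k, (X x k : ℚ) ^ τ k) * (Y x : ℚ) ^ (s : ℕ))),
    ?_, fun x => ?_⟩
  · have e : (fun x => ∑ s : Fin S, ∑ i : Fin h, ∑ j : Fin h,
        K s i j * ((((i * U x : ℕ).choose j : ℕ) : ℚ) *
          ((∏ k, (X x k : ℚ) ^ τ k) * (Y x : ℚ) ^ (s : ℕ)))) =
        ∑ s : Fin S, ∑ i : Fin h, ∑ j : Fin h, K s i j • (fun x => (((i * U x : ℕ).choose j : ℕ) : ℚ) *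
          ((∏ k, (X x k : ℚ) ^ τ k) * (Y x : ℚ) ^ (s : ℕ))) := by
      funext x
      simp only [Finset.sum_apply, Pi.smul_apply, smul_eq_mul]
    rw [e]
    refine Submodule.sum_mem _ (fun s _ => Submodule.sum_mem _ (fun i _ => Submodule.sum_mem _
      (fun j _ => Submodule.smul_mem _ _ ?_)))
    refine VS_mono X Y (show T' + j ≤ T' + h by have := j.2; omega) le_rfl ?_
    exact VS_mul_choose X Y u0 u U hU (mon_mem_VS X Y T' S τ s hτ s.2) i j
  · have e : ((monFun X Y T' S' ⟨(τ, t), hτ, ht⟩ x : ℤ) : ℚ) - ∑ s : Fin S, ∑ i : Fin h, ∑ j : Fin h,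
        K s i j * ((((i * U x : ℕ).choose j : ℕ) : ℚ) *
          ((∏ k, (X x k : ℚ) ^ τ k) * (Y x : ℚ) ^ (s : ℕ))) =
        ((∏ k, X x k ^ τ k : ℤ) : ℚ) * ((Y x : ℚ) ^ t - ∑ s : Fin S, ∑ i : Fin h, ∑ j : Fin h,
        K s i j * (((i * U x : ℕ).choose j : ℕ) : ℚ) * (Y x : ℚ) ^ (s : ℕ)) := by
      rw [mul_sub, Finset.mul_sum]
      simp only [monFun, Finset.mul_sum]
      push_cast
      congr 1
      refine Finset.sum_congr rfl (fun s _ => Finset.sum_congr rfl (fun i _ =>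
        Finset.sum_congr rfl (fun j _ => by ring)))
    rw [e, padicNorm.mul]
    calc _ ≤ 1 * ((ℓ : ℚ) ^ g)⁻¹ :=
          mul_le_mul (padicNorm.of_int _) (hK (U x) (Y x) (hY x)) (padicNorm.nonneg _) zero_le_one
      _ = _ := one_mul _

lemma finrank_VS_le [Finite E] (T S : ℕ) :
    finrank ℚ (VS X Y T S) ≤ S * (T + Fintype.card κ).choose (Fintype.card κ) := by
  classical
  let F : Finset ((Option κ →₀ ℕ) × ℕ) := (Finset.finsuppAntidiag Finset.univ T) ×ˢ Finset.range S
  let v : (Option κ →₀ ℕ) × ℕ → (E → ℚ) := fun q x => (∏ i, (X x i : ℚ) ^ q.1 (some i)) * (Y x : ℚ) ^ q.2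
  have h1 : VS X Y T S ≤ Submodule.span ℚ ((F.image v : Finset (E → ℚ)) : Set (E → ℚ)) := by
    apply Submodule.span_mono
    rintro _ ⟨⟨⟨τ, s⟩, h1, h2⟩, rfl⟩
    simp only at h1 h2
    rw [Finset.mem_coe, Finset.mem_image]
    refine ⟨(Finsupp.equivFunOnFinite.symm (fun o => o.elim (T - ∑ i, τ i) τ), s), ?_, ?_⟩
    · simp only [F, Finset.mem_product, Finset.mem_finsuppAntidiag, Finset.mem_range]
      refine ⟨⟨?_, by simp⟩, h2⟩
      rw [Fintype.sum_option]
      simp only [Finsupp.equivFunOnFinite_symm_apply_apply, Option.elim]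
      omega
    · funext x
      simp [v, monFun]
  have h2 : (Set.finrank ℚ ((F.image v : Finset (E → ℚ)) : Set (E → ℚ))) ≤ (F.image v).card :=
    finrank_span_finset_le_card _
  refine (Submodule.finrank_mono h1).trans (h2.trans (Finset.card_image_le.trans (le_of_eq ?_)))
  simp only [F, Finset.card_product, Finset.card_range, Finset.card_finsuppAntidiag_nat_eq_choose, Finset.card_univ,
    Fintype.card_option]
  rw [mul_comm]
  congr 1
  rw [show Fintype.card κ + 1 + T - 1 = T + Fintype.card κ by omega]
  exact Nat.choose_symm_add
end

end

section

open Module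

section
variable {E κ : Type*} [Fintype κ] (X : E → κ → ℤ) (Y : E → ℤ)

lemma flt_int (Q : ℕ) [hQ : Fact Q.Prime] (z : ℤ) (hz : ¬ (Q : ℤ) ∣ z) :
    (Q : ℤ) ∣ 1 - z ^ (Q - 1) := by
  have := Int.ModEq.pow_card_sub_one_eq_one hQ.out
    (n := z) ((Nat.Prime.coprime_iff_not_dvd hQ.out).mpr (by
      intro h; exact hz (Int.natCast_dvd.mpr h)) |>.symm |> fun h => by
        rw [Int.isCoprime_iff_nat_coprime]; simpa using h)
  exact this.dvd

lemma indicator_approx (Q g : ℕ) [hQ : Fact Q.Prime] (z : ℤ) :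
    (Q : ℤ) ^ g ∣ (if (Q : ℤ) ∣ z then 1 else 0) - (1 - (1 - (1 - z ^ (Q - 1)) ^ g) ^ g) := by
  have hQ1 : Q - 1 ≠ 0 := by have := hQ.out.two_le; omega
  split_ifs with h
  · rw [sub_sub_cancel]
    apply pow_dvd_pow_of_dvd
    have h1 : (Q : ℤ) ∣ z ^ (Q - 1) := dvd_pow h hQ1
    have h2 := sub_dvd_pow_sub_pow 1 (1 - z ^ (Q - 1)) g
    rw [one_pow, sub_sub_cancel] at h2
    exact h1.trans h2
  · have h1 := flt_int Q z h
    have h2 : (Q : ℤ) ^ g ∣ (1 - z ^ (Q - 1)) ^ g := pow_dvd_pow_of_dvd h1 g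
    have h3 := sub_dvd_pow_sub_pow 1 (1 - (1 - z ^ (Q - 1)) ^ g) g
    rw [one_pow, sub_sub_cancel] at h3
    rw [zero_sub, dvd_neg]
    exact h2.trans h3

lemma mon_poly_mem_VS (T S : ℕ) (τ : κ → ℕ) (hτ : ∑ i, τ i ≤ T) (p : Polynomial ℚ)
    (hp : p.natDegree < S) :
    (fun x => ((∏ i, (X x i : ℚ) ^ τ i) * p.eval (Y x : ℚ))) ∈ VS X Y T S := by
  have : (fun x => ((∏ i, (X x i : ℚ) ^ τ i) * p.eval (Y x : ℚ))) =
      ∑ s ∈ Finset.range S, p.coeff s • (fun x => ((∏ i, (X x i : ℚ) ^ τ i) * (Y x : ℚ) ^ s)) := by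
    funext x
    rw [Polynomial.eval_eq_sum_range' hp, Finset.mul_sum]
    simp only [Finset.sum_apply, Pi.smul_apply, smul_eq_mul]
    exact Finset.sum_congr rfl (fun s _ => by ring)
  rw [this]
  refine Submodule.sum_mem _ (fun s hs => Submodule.smul_mem _ _ ?_)
  exact mon_mem_VS X Y T S τ s hτ (Finset.mem_range.mp hs)

/-- family for the second step -/
def indFun (Q T : ℕ) : (E × {τ : κ → ℕ // ∑ i, τ i ≤ T}) → E → ℤ :=
  fun p x => if (Q : ℤ) ∣ Y x - Y p.1 then ∏ i, X x i ^ p.2.1 i else 0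

lemma final_lower [Fintype E] (N Q g T S H : ℕ) [hN : Fact N.Prime] [hQ : Fact Q.Prime]
    (hinj : ∀ x y, (∀ i, (N : ℤ) ∣ X x i - X y i) → (Q : ℤ) ∣ Y x - Y y → x = y)
    (hT : Fintype.card κ * (N - 1) ≤ T) (hS : g * g * (Q - 1) < S)
    (hH : 2 ≤ H) (hb : ∀ (τ : κ → ℕ) x, ∑ i, τ i ≤ T → |∏ i, X x i ^ τ i| ≤ H)
    (hbig : (Fintype.card E * H) ^ 2 ≤ Q ^ g) :
    Fintype.card E ≤ 2 * finrank ℚ (VS X Y T S) := by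
  classical
  have h1 : finrank ℚ (Submodule.span ℚ (Set.range (fun p x => (indFun X Y Q T p x : ℚ)))) ≤
      2 * finrank ℚ (VS X Y T S) := by
    refine rt_one Q g H (VS X Y T S) (indFun X Y Q T) ?_ hH ?_ hbig
    · rintro ⟨x0, τ, hτ⟩
      let p : Polynomial ℚ := 1 - (1 - (1 - (Polynomial.X - Polynomial.C (Y x0 : ℚ)) ^ (Q - 1)) ^ g) ^ g
      have hp : p.natDegree ≤ g * (g * ((Q - 1) * 1)) := by
        have hsub : ∀ (q : Polynomial ℚ) (n : ℕ), q.natDegree ≤ n → (1 - q).natDegree ≤ n := by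
          intro q n hq
          refine (Polynomial.natDegree_sub_le _ _).trans ?_
          simp [hq]
        refine hsub _ _ (Polynomial.natDegree_pow_le_of_le _ ?_)
        refine hsub _ _ (Polynomial.natDegree_pow_le_of_le _ ?_)
        refine hsub _ _ (Polynomial.natDegree_pow_le_of_le _ ?_)
        rw [Polynomial.natDegree_X_sub_C]
      refine ⟨_, mon_poly_mem_VS X Y T S τ hτ p (lt_of_le_of_lt hp (by
        rw [mul_one, ← mul_assoc]; exact hS)), fun x => ?_⟩
      have h2 := indicator_approx Q g (Y x - Y x0)
      have e : ((indFun X Y Q T (x0, ⟨τ, hτ⟩) x : ℤ) : ℚ) - (∏ i, (X x i : ℚ) ^ τ i) * p.eval (Y x : ℚ) =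
          (((∏ i, X x i ^ τ i) * ((if (Q : ℤ) ∣ (Y x - Y x0) then 1 else 0) -
            (1 - (1 - (1 - (Y x - Y x0) ^ (Q - 1)) ^ g) ^ g)) : ℤ) : ℚ) := by
        simp only [indFun, p, Polynomial.eval_sub, Polynomial.eval_pow, Polynomial.eval_one,
          Polynomial.eval_X, Polynomial.eval_C]
        split_ifs <;> push_cast <;> ring
      rw [e]
      exact padicNorm_le_of_dvd _ _ _ (h2.mul_left _)
    · rintro ⟨x0, τ, hτ⟩ x
      simp only [indFun]
      split_ifs
      · exact hb τ x hτ
      · simp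
  refine le_trans ?_ h1
  apply rt_two N
  intro x0
  let p : MvPolynomial κ ℚ := ∏ i, (1 - (MvPolynomial.X i - MvPolynomial.C (X x0 i : ℚ)) ^ (N - 1))
  have hp : p.totalDegree ≤ T := by
    refine (MvPolynomial.totalDegree_finsetProd _ _).trans (le_trans ?_ hT)
    have : ∀ i ∈ (Finset.univ : Finset κ), (1 - (MvPolynomial.X i - MvPolynomial.C (X x0 i : ℚ)) ^ (N - 1) :
        MvPolynomial κ ℚ).totalDegree ≤ N - 1 := by
      intro i _
      refine (MvPolynomial.totalDegree_sub _ _).trans (max_le (by simp) ?_)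
      refine (MvPolynomial.totalDegree_pow _ _).trans ?_
      have : (MvPolynomial.X i - MvPolynomial.C (X x0 i : ℚ) : MvPolynomial κ ℚ).totalDegree ≤ 1 := by
        refine (MvPolynomial.totalDegree_sub _ _).trans (max_le (by simp) (by
          rw [MvPolynomial.totalDegree_C]; omega))
      calc _ ≤ (N - 1) * 1 := Nat.mul_le_mul_left _ this
        _ = _ := mul_one _
    refine (Finset.sum_le_card_nsmul _ _ _ this).trans (le_of_eq (by simp))
  refine ⟨fun x => (if (Q : ℤ) ∣ Y x - Y x0 then 1 else 0) * MvPolynomial.eval (fun i => (X x i : ℚ)) p, ?_,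
    fun x => ?_⟩
  · have e : (fun x => (if (Q : ℤ) ∣ Y x - Y x0 then 1 else 0) *
        MvPolynomial.eval (fun i => (X x i : ℚ)) p) =
        ∑ d ∈ p.support, p.coeff d • (fun x => (if (Q : ℤ) ∣ Y x - Y x0 then 1 else 0) *
          ∏ i, (X x i : ℚ) ^ d i) := by
      funext x
      rw [MvPolynomial.eval_eq', Finset.mul_sum]
      simp only [Finset.sum_apply, Pi.smul_apply, smul_eq_mul]
      exact Finset.sum_congr rfl (fun s _ => by ring)
    rw [e]
    refine Submodule.sum_mem _ (fun d hd => Submodule.smul_mem _ _ (Submodule.subset_span ?_))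
    have hdT : ∑ i, d i ≤ T := by
      have := (MvPolynomial.le_totalDegree hd).trans hp
      rwa [Finsupp.sum_fintype _ _ (fun _ => rfl)] at this
    refine ⟨(x0, ⟨d, hdT⟩), ?_⟩
    funext x
    simp only [indFun]
    split_ifs <;> simp
  · have e : (if x = x0 then (1 : ℚ) else 0) - (if (Q : ℤ) ∣ Y x - Y x0 then 1 else 0) *
        MvPolynomial.eval (fun i => (X x i : ℚ)) p =
        (((if x = x0 then 1 else 0) - (if (Q : ℤ) ∣ Y x - Y x0 then 1 else 0) *
          ∏ i, (1 - (X x i - X x0 i) ^ (N - 1)) : ℤ) : ℚ) := by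
      simp only [p, map_prod, map_sub, map_pow, map_one, MvPolynomial.eval_X, MvPolynomial.eval_C]
      push_cast
      rfl
    rw [e]
    apply padicNorm_le_of_dvd
    rw [pow_one]
    have hN1 : N - 1 ≠ 0 := by have := hN.out.two_le; omega
    by_cases hx : x = x0
    · subst hx
      simp [hN1]
    · by_cases hq : (Q : ℤ) ∣ Y x - Y x0
      · have : ∃ i, ¬ (N : ℤ) ∣ X x i - X x0 i := by
          by_contra hall
          push Not at hall
          exact hx (hinj x x0 hall hq)
        obtain ⟨i, hi⟩ := this
        simp only [hx, hq, if_true, if_false, one_mul, zero_sub, dvd_neg]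
        exact (flt_int N _ hi).trans (Finset.dvd_prod_of_mem _ (Finset.mem_univ i))
      · simp [hx, hq]
end

end

section

lemma prime_lemma (x M : ℕ) (hx : 2 ^ 12 ≤ x) (hM : M ≠ 0) (hMx : M ≤ 2 ^ x) :
    ∃ p, p.Prime ∧ x < p ∧ p ≤ 16 * x ∧ ¬ p ∣ M := by
  by_contra hcon
  push Not at hcon
  have h1 := Chebyshev.theta_ge (16 * x)
  have h2 := Chebyshev.theta_le_log4_mul_x (x := (x : ℝ)) (by positivity)
  rw [Chebyshev.theta_eq_log_primorial] at h1 h2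
  have hdvd : primorial (16 * x) ∣ primorial x * M := by
    have hsplit : primorial (16 * x) = primorial x *
        ∏ p ∈ (Finset.Ioc x (16 * x)).filter Nat.Prime, p := by
      unfold primorial
      rw [← Finset.prod_union]
      · apply Finset.prod_congr _ (fun _ _ => rfl)
        ext p
        simp only [Finset.mem_union, Finset.mem_filter, Finset.mem_Ioc, Finset.mem_range]
        constructor
        · rintro ⟨h, hp⟩
          by_cases hpx : p < x + 1
          · exact Or.inl ⟨hpx, hp⟩
          · exact Or.inr ⟨⟨by omega, by omega⟩, hp⟩
        · rintro (⟨h, hp⟩ | ⟨h, hp⟩)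
          · exact ⟨by omega, hp⟩
          · exact ⟨by omega, hp⟩
      · rw [Finset.disjoint_left]
        intro p hp hp'
        simp only [Finset.mem_filter, Finset.mem_Ioc, Finset.mem_range] at hp hp'
        omega
    rw [hsplit]
    apply mul_dvd_mul_left
    apply Finset.prod_primes_dvd
    · intro p hp
      exact (Finset.mem_filter.mp hp).2.prime
    · intro p hp
      have := Finset.mem_filter.mp hp
      have h3 := Finset.mem_Ioc.mp this.1
      exact hcon p this.2 h3.1 h3.2
  have hle : primorial (16 * x) ≤ primorial x * M :=
    Nat.le_of_dvd (Nat.mul_pos (primorial_pos x) (Nat.pos_of_ne_zero hM)) hdvd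
  have h3 : Real.log (primorial (16 * x)) ≤ Real.log (primorial x) + x * Real.log 2 := by
    have hp0 : (0 : ℝ) < primorial x := by exact_mod_cast primorial_pos x
    have hp1 : (0 : ℝ) < primorial (16 * x) := by exact_mod_cast primorial_pos _
    calc Real.log (primorial (16 * x)) ≤ Real.log (primorial x * 2 ^ x) := by
          apply Real.log_le_log hp1
          exact_mod_cast hle.trans (Nat.mul_le_mul_left _ hMx)
      _ = _ := by
          rw [Real.log_mul hp0.ne' (by positivity), Real.log_pow]
  simp only [Nat.floor_natCast] at h1 h2
  have h4 : Real.log 4 = 2 * Real.log 2 := by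
    rw [show (4 : ℝ) = 2 ^ 2 by norm_num, Real.log_pow]; norm_num
  rw [h4] at h2
  set n : ℝ := ((16 * x : ℕ) : ℝ) with hn
  have hnx : n = 16 * x := by rw [hn]; push_cast; ring
  set y : ℝ := √(√n) with hy
  have hn0 : 0 ≤ n := by positivity
  have hy2 : y ^ 2 = √n := Real.sq_sqrt (Real.sqrt_nonneg _)
  have hy4 : y ^ 4 = n := by
    rw [show y ^ 4 = (y ^ 2) ^ 2 by ring, hy2, Real.sq_sqrt hn0]
  have hnbig : (16 : ℝ) ^ 4 ≤ n := by
    rw [hnx]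
    have : ((2 ^ 12 : ℕ) : ℝ) ≤ x := by exact_mod_cast hx
    push_cast at this
    linarith
  have hy16 : 16 ≤ y := by
    by_contra hlt
    push Not at hlt
    have : y ^ 4 < 16 ^ 4 := pow_lt_pow_left₀ hlt (Real.sqrt_nonneg _) (by norm_num)
    rw [hy4] at this
    linarith
  have hlogn : Real.log n ≤ 4 * y := by
    rw [← hy4, Real.log_pow]
    have := Real.log_le_self (Real.sqrt_nonneg √n)
    push_cast
    rw [← hy] at this
    linarith
  have hlogn1 : Real.log (n + 1) ≤ 4 * y + 1 := by
    have : n + 1 ≤ 2 * n := by linarith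
    calc Real.log (n + 1) ≤ Real.log (2 * n) := Real.log_le_log (by linarith) this
      _ = Real.log 2 + Real.log n := Real.log_mul (by norm_num) (by linarith)
      _ ≤ _ := by have := Real.log_two_lt_d9; linarith
  have h5 : 2 * √n * Real.log n ≤ 8 * y ^ 3 := by
    rw [← hy2]
    nlinarith [sq_nonneg y]
  have h6 := Real.log_two_gt_d9
  have h7 : 13 * (n / 16) * Real.log 2 ≤ 8 * y ^ 3 + (4 * y + 1) := by
    have : (x : ℝ) = n / 16 := by rw [hnx]; ring
    rw [this] at h2 h3
    nlinarith
  have h8 : 13 * (n / 16) * 0.693 ≤ 13 * (n / 16) * Real.log 2 := by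
    apply mul_le_mul_of_nonneg_left _ (by positivity)
    linarith
  rw [← hy4] at h7 h8
  have h9 : 16 * y ^ 3 ≤ y ^ 4 := by
    have : 0 ≤ y ^ 3 := by positivity
    nlinarith
  have h10 : 16 * 16 * y ≤ y ^ 3 := by nlinarith
  linarith

end

section

lemma binom_two (β : ℤ) (N : ℕ) : β ^ 2 ∣ (1 + β) ^ N - 1 - N * β := by
  have := trunc_binom β N 2
  simp only [Finset.sum_range_succ, Finset.sum_range_zero] at this
  simp at this
  convert this using 1
  ring

lemma gamma_pow (ℓ : ℕ) [hℓ : Fact ℓ.Prime] (s : ℕ) :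
    ∃ u : ℤ, (1 + (ℓ : ℤ) ^ 2) ^ (ℓ ^ s) = 1 + (ℓ : ℤ) ^ (s + 2) * u ∧ ¬ (ℓ : ℤ) ∣ u := by
  have hp : Prime (ℓ : ℤ) := Nat.prime_iff_prime_int.mp hℓ.out
  induction s with
  | zero =>
    refine ⟨1, by simp, ?_⟩
    intro h
    exact hp.not_isUnit (isUnit_of_dvd_one h)
  | succ s ih =>
    obtain ⟨u, hu, hul⟩ := ih
    obtain ⟨k, hk⟩ := binom_two ((ℓ : ℤ) ^ (s + 2) * u) ℓ
    refine ⟨u + (ℓ : ℤ) * ((ℓ : ℤ) ^ s * u ^ 2 * k), ?_, ?_⟩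
    · rw [pow_succ ℓ s, pow_mul, hu]
      have : (1 + (ℓ : ℤ) ^ (s + 2) * u) ^ ℓ = 1 + ℓ * ((ℓ : ℤ) ^ (s + 2) * u) +
        ((ℓ : ℤ) ^ (s + 2) * u) ^ 2 * k := by linarith
      rw [this]; ring
    · intro h
      exact hul ((Int.dvd_add_left (dvd_mul_right _ _)).mp h)

lemma gamma_not_dvd (ℓ : ℕ) [hℓ : Fact ℓ.Prime] (l : ℕ) : ¬ (ℓ : ℤ) ∣ (1 + (ℓ : ℤ) ^ 2) ^ l := by
  have hp : Prime (ℓ : ℤ) := Nat.prime_iff_prime_int.mp hℓ.out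
  intro h
  have h1 := hp.dvd_of_dvd_pow h
  have h2 : (ℓ : ℤ) ∣ 1 := (Int.dvd_add_left (dvd_pow_self _ two_ne_zero)).mp h1
  exact hp.not_isUnit (isUnit_of_dvd_one h2)

lemma exists_dlog (ℓ : ℕ) [hℓ : Fact ℓ.Prime] (x : ℤ) (hx : (ℓ : ℤ) ^ 2 ∣ x - 1) (V : ℕ) :
    ∃ l : ℕ, (ℓ : ℤ) ^ V ∣ x - (1 + (ℓ : ℤ) ^ 2) ^ l := by
  have hp : Prime (ℓ : ℤ) := Nat.prime_iff_prime_int.mp hℓ.out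
  suffices h : ∀ s : ℕ, ∃ l : ℕ, (ℓ : ℤ) ^ (s + 2) ∣ x - (1 + (ℓ : ℤ) ^ 2) ^ l by
    obtain ⟨l, hl⟩ := h V
    exact ⟨l, (pow_dvd_pow _ (by omega)).trans hl⟩
  intro s
  induction s with
  | zero => exact ⟨0, by simpa using hx⟩
  | succ s ih =>
    obtain ⟨l, y, hy⟩ := ih
    obtain ⟨u, hu, hul⟩ := gamma_pow ℓ s
    have hg := gamma_not_dvd ℓ l
    have hcop : IsCoprime ((1 + (ℓ : ℤ) ^ 2) ^ l * u) (ℓ : ℤ) := by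
      rw [isCoprime_comm]
      refine (Prime.coprime_iff_not_dvd hp).mpr ?_
      intro h
      rcases hp.dvd_or_dvd h with h | h
      · exact hg h
      · exact hul h
    obtain ⟨a, b, hab⟩ := hcop
    set k : ℕ := ((a * y) % ℓ).toNat with hk
    have hl0 : (ℓ : ℤ) ≠ 0 := hp.ne_zero
    have hkz : (k : ℤ) = (a * y) % ℓ := Int.toNat_of_nonneg (Int.emod_nonneg _ hl0)
    have hkd : (ℓ : ℤ) ∣ a * y - k := by
      rw [hkz]; exact Int.dvd_self_sub_emod
    obtain ⟨q, hq⟩ := binom_two ((ℓ : ℤ) ^ (s + 2) * u) k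
    refine ⟨l + ℓ ^ s * k, ?_⟩
    rw [pow_add _ l, pow_mul, hu]
    have e : (1 + (ℓ : ℤ) ^ (s + 2) * u) ^ k = 1 + k * ((ℓ : ℤ) ^ (s + 2) * u) +
        ((ℓ : ℤ) ^ (s + 2) * u) ^ 2 * q := by linarith
    rw [e]
    set Γ := (1 + (ℓ : ℤ) ^ 2) ^ l
    have e2 : x - Γ * (1 + k * ((ℓ : ℤ) ^ (s + 2) * u) + ((ℓ : ℤ) ^ (s + 2) * u) ^ 2 * q) =
        (ℓ : ℤ) ^ (s + 2) * ((Γ * u) * (a * y - k) + ℓ * (b * y - (ℓ : ℤ) ^ (s + 1) * u ^ 2 * q * Γ)) := by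
      have : y = (a * (Γ * u) + b * ℓ) * y := by rw [hab, one_mul]
      have h3 : x = Γ + (ℓ : ℤ) ^ (s + 2) * y := by linarith
      rw [h3]
      linear_combination ((ℓ : ℤ) ^ (s + 2)) * this
    rw [e2, show s + 1 + 2 = (s + 2) + 1 by ring, pow_succ]
    exact mul_dvd_mul_left _ (dvd_add (hkd.mul_left _) (dvd_mul_right _ _))

lemma gamma_order (ℓ : ℕ) [hℓ : Fact ℓ.Prime] (v n : ℕ)
    (h : (ℓ : ℤ) ^ (v + 2) ∣ (1 + (ℓ : ℤ) ^ 2) ^ n - 1) : ℓ ^ v ∣ n := by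
  have hp : Prime (ℓ : ℤ) := Nat.prime_iff_prime_int.mp hℓ.out
  rcases Nat.eq_zero_or_pos n with rfl | hn
  · simp
  obtain ⟨s, n', hn', rfl⟩ := Nat.exists_eq_pow_mul_and_not_dvd hn.ne' ℓ hℓ.out.ne_one
  obtain ⟨u, hu, hul⟩ := gamma_pow ℓ s
  by_cases hvs : v ≤ s
  · exact (pow_dvd_pow _ hvs).mul_right _
  exfalso
  push Not at hvs
  rw [pow_mul, hu] at h
  obtain ⟨q, hq⟩ := binom_two ((ℓ : ℤ) ^ (s + 2) * u) n'
  have e : (1 + (ℓ : ℤ) ^ (s + 2) * u) ^ n' - 1 =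
      (ℓ : ℤ) ^ (s + 2) * (n' * u + ℓ * ((ℓ : ℤ) ^ (s + 1) * u ^ 2 * q)) := by
    have : (1 + (ℓ : ℤ) ^ (s + 2) * u) ^ n' - 1 = n' * ((ℓ : ℤ) ^ (s + 2) * u) +
        ((ℓ : ℤ) ^ (s + 2) * u) ^ 2 * q := by linarith
    rw [this]; ring
  rw [e] at h
  have h2 : (ℓ : ℤ) ^ (s + 2) * ℓ ∣ (ℓ : ℤ) ^ (s + 2) * (n' * u + ℓ * ((ℓ : ℤ) ^ (s + 1) * u ^ 2 * q)) := by
    rw [← pow_succ]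
    exact (pow_dvd_pow _ (by omega)).trans h
  have h3 := (mul_dvd_mul_iff_left (pow_ne_zero _ hp.ne_zero)).mp h2
  have h4 := (Int.dvd_add_left (dvd_mul_right _ _)).mp h3
  rcases hp.dvd_or_dvd h4 with h | h
  · exact hn' (by exact_mod_cast h)
  · exact hul h

lemma gamma_order' (ℓ : ℕ) [hℓ : Fact ℓ.Prime] (v a b : ℕ)
    (h : (ℓ : ℤ) ^ (v + 2) ∣ (1 + (ℓ : ℤ) ^ 2) ^ a - (1 + (ℓ : ℤ) ^ 2) ^ b) :
    (ℓ : ℤ) ^ v ∣ (a : ℤ) - b := by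
  have hp : Prime (ℓ : ℤ) := Nat.prime_iff_prime_int.mp hℓ.out
  have key : ∀ a b : ℕ, b ≤ a → (ℓ : ℤ) ^ (v + 2) ∣ (1 + (ℓ : ℤ) ^ 2) ^ a - (1 + (ℓ : ℤ) ^ 2) ^ b →
      (ℓ : ℤ) ^ v ∣ (a : ℤ) - b := by
    intro a b hab h
    have e : (1 + (ℓ : ℤ) ^ 2) ^ a - (1 + (ℓ : ℤ) ^ 2) ^ b =
        (1 + (ℓ : ℤ) ^ 2) ^ b * ((1 + (ℓ : ℤ) ^ 2) ^ (a - b) - 1) := by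
      rw [mul_sub, ← pow_add, Nat.add_sub_cancel' hab, mul_one]
    rw [e] at h
    have hcop : IsCoprime ((ℓ : ℤ) ^ (v + 2)) ((1 + (ℓ : ℤ) ^ 2) ^ b) :=
      IsCoprime.pow_left ((Prime.coprime_iff_not_dvd hp).mpr (gamma_not_dvd ℓ b))
    have h1 := hcop.dvd_of_dvd_mul_left h
    have h2 := gamma_order ℓ v (a - b) h1
    rw [← Nat.cast_sub hab]
    exact_mod_cast h2
  rcases le_total b a with hab | hab
  · exact key a b hab h
  · rw [← dvd_neg, neg_sub]
    apply key b a hab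
    rw [← dvd_neg, neg_sub]
    exact h

end

section

section
variable {ι : Type} [Fintype ι] [DecidableEq ι] (i0 : ι)

/-- the auxiliary coordinates -/
def Xc (e : ι → ℤ) (lam : ι → ℕ) (i : {i : ι // i ≠ i0}) : ℤ := e i0 * lam i - e i * lam i0

/-- the monomial -/
def Yc (α : ι → ℕ) (lam : ι → ℕ) : ℕ := ∏ i, α i ^ lam i

lemma Yc_le (α a : ι → ℕ) (hα : ∀ i, α i ≤ 2 ^ a i) (P : ℕ) (lam : ι → ℕ)
    (h : ∀ i, a i * lam i ≤ P) : Yc α lam ≤ 2 ^ (Fintype.card ι * P) := by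
  unfold Yc
  calc ∏ i, α i ^ lam i ≤ ∏ _i : ι, 2 ^ P := by
        refine Finset.prod_le_prod' (fun i _ => ?_)
        calc α i ^ lam i ≤ (2 ^ a i) ^ lam i := Nat.pow_le_pow_left (hα i) _
          _ = 2 ^ (a i * lam i) := by rw [pow_mul]
          _ ≤ 2 ^ P := Nat.pow_le_pow_right (by norm_num) (h i)
    _ = _ := by simp [pow_mul, mul_comm]

lemma Yc_pos (α : ι → ℕ) (hα : ∀ i, 1 ≤ α i) (lam : ι → ℕ) : 1 ≤ Yc α lam :=
  Finset.one_le_prod' (fun i _ => Nat.one_le_pow _ _ (hα i))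

/-- equal differences -/
lemma diff_eq (e : ι → ℤ) (P N : ℕ) (hN : N.Prime) (hNP : 2 * P < N) (hNe : ¬ (N : ℤ) ∣ e i0)
    (l1 l2 m1 m2 : ι → ℕ) (h1 : ∀ i, l1 i < P) (h2 : ∀ i, l2 i < P) (h3 : ∀ i, m1 i < P)
    (h4 : ∀ i, m2 i < P) (h0 : l1 i0 + m2 i0 = l2 i0 + m1 i0)
    (hl : ∀ i, (N : ℤ) ∣ Xc i0 e l1 i - Xc i0 e l2 i)
    (hm : ∀ i, (N : ℤ) ∣ Xc i0 e m1 i - Xc i0 e m2 i) (i : ι) : l1 i + m2 i = l2 i + m1 i := by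
  by_cases hi : i = i0
  · rw [hi]; exact h0
  have hp : Prime (N : ℤ) := Nat.prime_iff_prime_int.mp hN
  have h5 := dvd_sub (hl ⟨i, hi⟩) (hm ⟨i, hi⟩)
  simp only [Xc] at h5
  have h0' : (l1 i0 : ℤ) + m2 i0 = l2 i0 + m1 i0 := by exact_mod_cast h0
  have e1 : e i0 * (l1 i : ℤ) - e i * l1 i0 - (e i0 * l2 i - e i * l2 i0) -
      (e i0 * m1 i - e i * m1 i0 - (e i0 * m2 i - e i * m2 i0)) =
      e i0 * ((l1 i : ℤ) + m2 i - l2 i - m1 i) := by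
    linear_combination (- e i) * h0'
  rw [e1] at h5
  have h6 := (hp.dvd_or_dvd h5).resolve_left hNe
  have h7 : (l1 i : ℤ) + m2 i - l2 i - m1 i = 0 := by
    apply Int.eq_zero_of_abs_lt_dvd h6
    have := h1 i; have := h2 i; have := h3 i; have := h4 i
    rw [abs_lt]; constructor <;> omega
  omega

lemma exists_Q (α : ι → ℕ) (e : ι → ℤ) (P N b : ℕ) (hN : N.Prime) (hNP : 2 * P < N)
    (hNe : ¬ (N : ℤ) ∣ e i0) (hP : 2 ^ 12 ≤ P) (hb : 1 ≤ b)
    (hα1 : ∀ i, 1 ≤ α i) (hαb : ∏ i, α i ≤ 2 ^ b)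
    (hinj : ∀ x y : ι → ℕ, Yc α x = Yc α y → x = y)
    (s : Set (ι → ℕ)) (hs : ∀ x ∈ s, (∀ i, x i < P) ∧ Yc α x ≤ 2 ^ b) :
    ∃ Q : ℕ, Q.Prime ∧ Q ≤ 16 * (P * b) ∧ ∀ x ∈ s, ∀ y ∈ s,
      (∀ i, (N : ℤ) ∣ Xc i0 e x i - Xc i0 e y i) → (Q : ℤ) ∣ (Yc α x : ℤ) - Yc α y → x = y := by
  classical
  let pr : ℕ → (ι → ℕ) → (ι → ℕ) → Prop := fun j x y =>
    x ∈ s ∧ y ∈ s ∧ (∀ i, (N : ℤ) ∣ Xc i0 e x i - Xc i0 e y i) ∧ x i0 = y i0 + j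
  have hex : ∀ j, ∃ z : ℕ, 1 ≤ z ∧ z ≤ 2 ^ b ∧ ((∃ x y, pr (j + 1) x y) →
      ∃ x y, pr (j + 1) x y ∧ (z : ℤ) = |(Yc α x : ℤ) - Yc α y|) := by
    intro j
    by_cases h : ∃ x y, pr (j + 1) x y
    · obtain ⟨x, y, hxy⟩ := h
      refine ⟨((Yc α x : ℤ) - Yc α y).natAbs, ?_, ?_, fun _ => ⟨x, y, hxy, by simp⟩⟩
      · have : x ≠ y := by
          intro h; have := hxy.2.2.2; rw [h] at this; omega
        have h2 : Yc α x ≠ Yc α y := fun h => this (hinj x y h)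
        omega
      · have h1 := (hs x hxy.1).2
        have h2 := (hs y hxy.2.1).2
        omega
    · exact ⟨1, le_rfl, Nat.one_le_pow _ _ (by norm_num), fun h' => absurd h' h⟩
  choose z hz1 hz2 hz3 using hex
  set M := (∏ i, α i) * ∏ j ∈ Finset.range (P - 1), z j with hM
  have hM0 : M ≠ 0 := by
    apply mul_ne_zero
    · exact Finset.prod_ne_zero_iff.mpr (fun i _ => by have := hα1 i; omega)
    · exact Finset.prod_ne_zero_iff.mpr (fun i _ => by have := hz1 i; omega)
  have hMle : M ≤ 2 ^ (P * b) := by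
    calc M ≤ 2 ^ b * ∏ _j ∈ Finset.range (P - 1), 2 ^ b :=
          Nat.mul_le_mul hαb (Finset.prod_le_prod' (fun j _ => hz2 j))
      _ = 2 ^ (P * b) := by
          rw [Finset.prod_const, Finset.card_range, ← pow_succ', ← pow_mul, mul_comm]
          congr 2
          omega
  obtain ⟨Q, hQ, -, hQ2, hQ3⟩ := prime_lemma (P * b) M (by nlinarith) hM0 hMle
  refine ⟨Q, hQ, hQ2, ?_⟩
  have hQα : ∀ i, ¬ Q ∣ α i := fun i h =>
    hQ3 (((h.trans (Finset.dvd_prod_of_mem α (Finset.mem_univ i)))).mul_right _)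
  have hQY : ∀ x, ¬ Q ∣ Yc α x := by
    intro x h
    obtain ⟨i, _, hi⟩ := (Prime.dvd_finsetProd_iff hQ.prime _).mp h
    exact hQα i (hQ.dvd_of_dvd_pow hi)
  have hQz : ∀ j, j + 1 < P → ¬ Q ∣ z j := fun j hj h =>
    hQ3 ((h.trans (Finset.dvd_prod_of_mem z (Finset.mem_range.mpr (by omega)))).mul_left _)
  have key : ∀ x ∈ s, ∀ y ∈ s, (∀ i, (N : ℤ) ∣ Xc i0 e x i - Xc i0 e y i) →
      (Q : ℤ) ∣ (Yc α x : ℤ) - Yc α y → x i0 ≤ y i0 := by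
    intro x hx y hy hN' hQ'
    by_contra hlt
    push Not at hlt
    obtain ⟨j, hj⟩ : ∃ j, x i0 = y i0 + (j + 1) := ⟨x i0 - y i0 - 1, by omega⟩
    obtain ⟨u, v, huv, hzuv⟩ := hz3 j ⟨x, y, hx, hy, hN', hj⟩
    have hd := diff_eq i0 e P N hN hNP hNe x y u v (hs x hx).1 (hs y hy).1 (hs u huv.1).1
      (hs v huv.2.1).1 (by have := huv.2.2.2; omega) hN' huv.2.2.1
    have hYY : Yc α x * Yc α v = Yc α y * Yc α u := by
      unfold Yc
      rw [← Finset.prod_mul_distrib, ← Finset.prod_mul_distrib]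
      exact Finset.prod_congr rfl (fun i _ => by rw [← pow_add, ← pow_add, hd i])
    have hYY' : (Yc α x : ℤ) * Yc α v = Yc α y * Yc α u := by exact_mod_cast hYY
    have hdv : (Q : ℤ) ∣ (Yc α x : ℤ) * ((Yc α u : ℤ) - Yc α v) := by
      have : (Yc α x : ℤ) * ((Yc α u : ℤ) - Yc α v) = ((Yc α x : ℤ) - Yc α y) * Yc α u := by
        linear_combination - hYY'
      rw [this]; exact hQ'.mul_right _
    rcases (Nat.prime_iff_prime_int.mp hQ).dvd_or_dvd hdv with h | h
    · exact hQY x (by exact_mod_cast h)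
    · apply hQz j (by have := (hs x hx).1 i0; omega)
      have : (Q : ℤ) ∣ (z j : ℤ) := by rw [hzuv]; exact (dvd_abs _ _).mpr h
      exact_mod_cast this
  intro x hx y hy hN' hQ'
  have h1 := key x hx y hy hN' hQ'
  have h2 := key y hy x hx (fun i => by rw [← dvd_neg, neg_sub]; exact hN' i)
    (by rw [← dvd_neg, neg_sub]; exact hQ')
  funext i
  have := diff_eq i0 e P N hN hNP hNe x y x x (hs x hx).1 (hs y hy).1 (hs x hx).1
      (hs x hx).1 (by omega) hN' (fun i => by simp) i
  omega

end

end

section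

section
lemma gamma_congr_le (ℓ : ℕ) [Fact ℓ.Prime] (V x z : ℕ) (hxz : x ≤ z)
    (h : (ℓ : ℤ) ^ V ∣ (z : ℤ) - x) :
    (ℓ : ℤ) ^ V ∣ (1 + (ℓ : ℤ) ^ 2) ^ z - (1 + (ℓ : ℤ) ^ 2) ^ x := by
  have h1 : ℓ ^ V ∣ z - x := by
    have : ((ℓ ^ V : ℕ) : ℤ) ∣ ((z - x : ℕ) : ℤ) := by
      rw [Nat.cast_sub hxz]; exact_mod_cast h
    exact_mod_cast this
  obtain ⟨t, ht⟩ := h1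
  have hz : z = x + ℓ ^ V * t := by omega
  obtain ⟨u, hu, _⟩ := gamma_pow ℓ V
  have h2 : (ℓ : ℤ) ^ V ∣ ((1 + (ℓ : ℤ) ^ 2) ^ (ℓ ^ V)) ^ t - 1 ^ t := by
    refine dvd_trans ?_ (sub_dvd_pow_sub_pow _ _ t)
    rw [hu]
    refine ⟨(ℓ : ℤ) ^ 2 * u, by ring⟩
  rw [hz, pow_add, pow_mul]
  rw [one_pow] at h2
  obtain ⟨q, hq⟩ := h2
  exact ⟨(1 + (ℓ : ℤ) ^ 2) ^ x * q, by linear_combination (1 + (ℓ : ℤ) ^ 2) ^ x * hq⟩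

lemma gamma_congr (ℓ : ℕ) [Fact ℓ.Prime] (V x z : ℕ)
    (h : (ℓ : ℤ) ^ V ∣ (z : ℤ) - x) :
    (ℓ : ℤ) ^ V ∣ (1 + (ℓ : ℤ) ^ 2) ^ z - (1 + (ℓ : ℤ) ^ 2) ^ x := by
  rcases le_total x z with hx | hx
  · exact gamma_congr_le ℓ V x z hx h
  · rw [dvd_sub_comm]
    exact gamma_congr_le ℓ V z x hx ((dvd_sub_comm).mp h)

variable {ι : Type} [Fintype ι] [DecidableEq ι] (i0 : ι)

lemma Yc_congr (ℓ : ℕ) [Fact ℓ.Prime] (V : ℕ) (α l lam : ι → ℕ)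
    (hl : ∀ i, (ℓ : ℤ) ^ V ∣ (α i : ℤ) - (1 + (ℓ : ℤ) ^ 2) ^ l i) :
    (ℓ : ℤ) ^ V ∣ (Yc α lam : ℤ) - (1 + (ℓ : ℤ) ^ 2) ^ (∑ i, lam i * l i) := by
  unfold Yc
  push_cast
  rw [← Finset.prod_pow_eq_pow_sum]
  rw [← Int.modEq_iff_dvd]
  refine Int.ModEq.prod (fun i _ => ?_)
  rw [mul_comm, pow_mul]
  exact ((Int.modEq_iff_dvd).mpr (hl i)).pow _

lemma sum_Xc (e : ι → ℤ) (l lam : ι → ℕ) :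
    ∑ i : {i : ι // i ≠ i0}, Xc i0 e lam i * (l i : ℤ) =
      e i0 * ((∑ i, lam i * l i : ℕ) : ℤ) - lam i0 * ∑ i, e i * (l i : ℤ) := by
  have h1 : ∀ f : ι → ℤ, ∑ i, f i = f i0 + ∑ i : {i : ι // i ≠ i0}, f i := by
    intro f
    rw [Fintype.sum_eq_add_sum_subtype_ne f i0]
  push_cast
  rw [h1 (fun i => (lam i : ℤ) * l i), h1 (fun i => e i * (l i : ℤ))]
  simp only [Xc, mul_add, Finset.mul_sum]
  have : ∀ a b c d : ℤ, a + b - (c + d) = (a - c) + (b - d) := by intros; ring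
  rw [this, ← Finset.sum_sub_distrib]
  have h2 : e i0 * ((lam i0 : ℤ) * l i0) - lam i0 * (e i0 * l i0) = 0 := by ring
  rw [h2, zero_add]
  exact Finset.sum_congr rfl (fun i _ => by ring)

lemma pigeon {β : Type} [Fintype β] (f : β → ℕ) (M : ℕ) (hM : 0 < M) :
    ∃ x0, Fintype.card β ≤ (Fintype.card {b : β // f b % M = x0}) * M := by
  classical
  by_contra hcon
  push Not at hcon
  have h1 : Fintype.card β = ∑ x ∈ Finset.range M, Fintype.card {b : β // f b % M = x} := by
    rw [← Finset.card_univ, Finset.card_eq_sum_card_fiberwise (f := fun b => f b % M)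
      (t := Finset.range M) (fun b _ => by simpa using Nat.mod_lt _ hM)]
    refine Finset.sum_congr rfl (fun x _ => ?_)
    rw [Fintype.card_subtype]
  have h2 : Fintype.card β * M < M * Fintype.card β := by
    conv_lhs => rw [h1, Finset.sum_mul]
    have : ∑ x ∈ Finset.range M, Fintype.card {b : β // f b % M = x} * M
        < ∑ x ∈ Finset.range M, Fintype.card β :=
      Finset.sum_lt_sum_of_nonempty ⟨0, by simpa using hM⟩ (fun x _ => hcon x)
    simpa using this
  rw [mul_comm] at h2
  exact lt_irrefl _ h2

lemma Gsetup (α a : ι → ℕ) (P : ℕ) (ha1 : ∀ i, 1 ≤ a i) (haP : ∀ i, a i ≤ P)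
    (hα : ∀ i, α i ≤ 2 ^ a i) (hα1 : ∀ i, 1 ≤ α i)
    (hinj : ∀ x y : ι → ℕ, Yc α x = Yc α y → x = y)
    (ℓ : ℕ) [Fact ℓ.Prime] (m V : ℕ) (hmV : m ≤ V) (l : ι → ℕ)
    (hl : ∀ i, (ℓ : ℤ) ^ V ∣ (α i : ℤ) - (1 + (ℓ : ℤ) ^ 2) ^ l i)
    (e : ι → ℤ) (he0 : ¬ (ℓ : ℤ) ∣ e i0) (hel : (ℓ : ℤ) ^ V ∣ ∑ i, e i * (l i : ℤ))
    (B : ℕ) (hB : ∀ i, |e i| ≤ B) (hBP : B ≤ 2 ^ (2 * P)) (hP : 2 ^ 12 ≤ P) :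
    ∃ (E : Type) (_ : Fintype E) (X : E → {i : ι // i ≠ i0} → ℤ) (Y : E → ℤ) (U : E → ℕ)
      (u0 : ℚ) (u : {i : ι // i ≠ i0} → ℚ) (B0 c : ℤ) (N Q : ℕ),
      (∏ i, (P / a i) ≤ Fintype.card E * ℓ ^ m) ∧
      (Fintype.card E ≤ ∏ i, (P / a i)) ∧
      (∀ x, 1 ≤ Y x ∧ Y x ≤ 2 ^ (Fintype.card ι * P)) ∧
      (∀ x i, |X x i| ≤ 2 * B * P) ∧
      (∀ x, (U x : ℚ) = u0 + ∑ i, u i * X x i) ∧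
      (∀ x, (ℓ : ℤ) ^ V ∣ Y x - c * B0 ^ (U x)) ∧
      (ℓ : ℤ) ^ (m + 2) ∣ B0 - 1 ∧ ¬ (ℓ : ℤ) ∣ c ∧ N.Prime ∧ N ≤ 32 * P ∧ Q.Prime ∧
      Q ≤ 16 * (P * (Fintype.card ι * P)) ∧
      ∀ x y, (∀ i, (N : ℤ) ∣ X x i - X y i) → (Q : ℤ) ∣ Y x - Y y → x = y := by
  classical
  have hℓ : ℓ.Prime := Fact.out
  have hn : 1 ≤ Fintype.card ι := Fintype.card_pos_iff.mpr ⟨i0⟩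
  have hlam : ∀ (lam : (i : ι) → Fin (P / a i)) (i : ι), a i * (lam i : ℕ) ≤ P := fun lam i =>
    le_trans (Nat.mul_le_mul_left _ (lam i).2.le) (Nat.mul_div_le _ _)
  have hlamP : ∀ (lam : (i : ι) → Fin (P / a i)) (i : ι), (lam i : ℕ) < P := fun lam i =>
    lt_of_lt_of_le (lam i).2 (Nat.div_le_self _ _)
  obtain ⟨x0, hx0⟩ := pigeon (β := (i : ι) → Fin (P / a i))
    (fun lam => ∑ i, (lam i : ℕ) * l i) (ℓ ^ m) (pow_pos hℓ.pos _)
  have hcardbox : Fintype.card ((i : ι) → Fin (P / a i)) = ∏ i, (P / a i) := by simp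
  have he0' : e i0 ≠ 0 := by intro h; rw [h] at he0; simp at he0
  -- the prime N
  obtain ⟨N, hNp, hN1, hN2, hN3⟩ := prime_lemma (2 * P) (e i0).natAbs (by omega)
    (by simpa using he0') (by
      have h1 := hB i0
      have : ((e i0).natAbs : ℤ) ≤ B := by rwa [Int.natCast_natAbs]
      have : (e i0).natAbs ≤ B := by exact_mod_cast this
      omega)
  have hN3' : ¬ (N : ℤ) ∣ e i0 := fun h => hN3 (Int.natCast_dvd.mp h)
  obtain ⟨Q, hQp, hQ1, hQ2⟩ := exists_Q i0 α e P N (Fintype.card ι * P) hNp (by omega) hN3' hP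
    (by nlinarith) hα1
    (by
      have := Yc_le α a hα P (fun _ => 1) (fun i => by simpa using haP i)
      simpa [Yc] using this) hinj
    (Set.range (fun (lam : (i : ι) → Fin (P / a i)) (i : ι) => (lam i : ℕ)))
    (by
      rintro _ ⟨lam, rfl⟩
      exact ⟨hlamP lam, Yc_le α a hα P _ (hlam lam)⟩)
  -- inverse of e i0
  have hcop : IsCoprime (e i0) ((ℓ : ℤ) ^ V) := by
    apply IsCoprime.pow_right
    exact (((Nat.prime_iff_prime_int.mp hℓ).coprime_iff_not_dvd).mpr he0).symm
  obtain ⟨e', f', hef⟩ := hcop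
  let E := {lam : (i : ι) → Fin (P / a i) // (∑ i, (lam i : ℕ) * l i) % (ℓ ^ m) = x0}
  let nt : E → ι → ℕ := fun x i => (x.1 i : ℕ)
  let X : E → {i : ι // i ≠ i0} → ℤ := fun x => Xc i0 e (nt x)
  let s : E → ℤ := fun x => e' * ∑ i, X x i * (l i : ℤ)
  let M0 : ℤ := x0 + ∑ x : E, |s x|
  have hV1 : (1 : ℤ) ≤ (ℓ : ℤ) ^ V := one_le_pow₀ (by exact_mod_cast hℓ.pos)
  have hz0 : ∀ x, (x0 : ℤ) ≤ s x + M0 * (ℓ : ℤ) ^ V := by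
    intro x
    have h1 : |s x| ≤ ∑ x : E, |s x| :=
      Finset.single_le_sum (f := fun x => |s x|) (fun i _ => abs_nonneg _) (Finset.mem_univ x)
    have h2 : (0 : ℤ) ≤ M0 := by
      have : 0 ≤ |s x| := abs_nonneg _
      simp only [M0]; omega
    have h3 : M0 ≤ M0 * (ℓ : ℤ) ^ V := le_mul_of_one_le_right h2 hV1
    have h4 := neg_abs_le (s x)
    simp only [M0] at h3 ⊢
    omega
  have hzx : ∀ x : E, (ℓ : ℤ) ^ V ∣
      (s x + M0 * (ℓ : ℤ) ^ V) - ((∑ i, nt x i * l i : ℕ) : ℤ) := by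
    intro x
    obtain ⟨q, hq⟩ := hel
    refine ⟨M0 - f' * ((∑ i, nt x i * l i : ℕ) : ℤ) - e' * nt x i0 * q, ?_⟩
    have := sum_Xc i0 e l (nt x)
    rw [hq] at this
    simp only [s, X]
    rw [this]
    linear_combination ((∑ i, nt x i * l i : ℕ) : ℤ) * hef
  have hzm : ∀ x : E, ((ℓ ^ m : ℕ) : ℤ) ∣ (s x + M0 * (ℓ : ℤ) ^ V) - x0 := by
    intro x
    have h1 : ((ℓ ^ m : ℕ) : ℤ) ∣ (s x + M0 * (ℓ : ℤ) ^ V) - ((∑ i, nt x i * l i : ℕ) : ℤ) := by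
      refine dvd_trans ?_ (hzx x)
      push_cast
      exact pow_dvd_pow _ hmV
    have h2 : ((ℓ ^ m : ℕ) : ℤ) ∣ ((∑ i, nt x i * l i : ℕ) : ℤ) - x0 := by
      have h3 : (∑ i, nt x i * l i) % (ℓ ^ m) = x0 := x.2
      rw [← h3]
      rw [Int.natCast_mod]
      exact Int.dvd_self_sub_emod
    have := dvd_add h1 h2
    simpa using this
  have hU : ∀ x : E, ∃ U : ℕ, (s x + M0 * (ℓ : ℤ) ^ V) = x0 + (ℓ ^ m : ℕ) * U := by
    intro x
    obtain ⟨t, ht⟩ := hzm x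
    have hpos : (0 : ℤ) < ((ℓ ^ m : ℕ) : ℤ) := by exact_mod_cast pow_pos hℓ.pos m
    have : 0 ≤ t := by
      by_contra hneg
      push Not at hneg
      have := hz0 x
      nlinarith
    lift t to ℕ using this
    exact ⟨t, by linarith⟩
  choose U hU using hU
  have hℓQ : ((ℓ : ℚ) ^ m) ≠ 0 := pow_ne_zero _ (by exact_mod_cast hℓ.ne_zero)
  refine ⟨E, inferInstance, X, fun x => (Yc α (nt x) : ℤ), U,
    ((M0 : ℚ) * (ℓ : ℚ) ^ V - x0) / (ℓ : ℚ) ^ m, fun i => (e' : ℚ) * (l i : ℚ) / (ℓ : ℚ) ^ m,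
    (1 + (ℓ : ℤ) ^ 2) ^ (ℓ ^ m), (1 + (ℓ : ℤ) ^ 2) ^ x0, N, Q, ?_, ?_, ?_, ?_, ?_, ?_, ?_, ?_,
    hNp, by omega, hQp, hQ1, ?_⟩
  · rw [← hcardbox]; exact hx0
  · rw [← hcardbox]; exact Fintype.card_subtype_le _
  · intro x
    have h1 : 1 ≤ Yc α (nt x) := Yc_pos α hα1 _
    have h2 : Yc α (nt x) ≤ 2 ^ (Fintype.card ι * P) := Yc_le α a hα P _ (hlam x.1)
    exact ⟨by show (1 : ℤ) ≤ (Yc α (nt x) : ℤ); exact_mod_cast h1,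
      by show (Yc α (nt x) : ℤ) ≤ _; exact_mod_cast h2⟩
  · intro x i
    have h1 : (nt x i : ℤ) ≤ P := by exact_mod_cast (hlamP x.1 i).le
    have h2 : (nt x i0 : ℤ) ≤ P := by exact_mod_cast (hlamP x.1 i0).le
    have hB0 : (0 : ℤ) ≤ B := by positivity
    have h3 : |e i0 * (nt x i : ℤ)| ≤ B * P := by
      rw [abs_mul]
      exact mul_le_mul (hB _) (by simpa using h1) (abs_nonneg _) hB0
    have h4 : |e i * (nt x i0 : ℤ)| ≤ B * P := by
      rw [abs_mul]
      exact mul_le_mul (hB _) (by simpa using h2) (abs_nonneg _) hB0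
    have h5 : |e i0 * (nt x i : ℤ) - e i * (nt x i0 : ℤ)| ≤ _ := abs_sub _ _
    simp only [X, Xc]
    linarith
  · intro x
    have h1 : ((s x + M0 * (ℓ : ℤ) ^ V : ℤ) : ℚ) = ((x0 + (ℓ ^ m : ℕ) * U x : ℤ) : ℚ) := by
      rw [hU x]
    simp only [s] at h1
    push_cast at h1
    have h2 : ∑ i : {i : ι // i ≠ i0}, (e' : ℚ) * (l i : ℚ) / (ℓ : ℚ) ^ m * (X x i : ℚ) =
        (e' * ∑ i, (X x i : ℚ) * (l i : ℚ)) / (ℓ : ℚ) ^ m := by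
      rw [Finset.mul_sum, Finset.sum_div]
      exact Finset.sum_congr rfl (fun i _ => by ring)
    rw [h2]
    field_simp
    linarith
  · intro x
    rw [← pow_mul, ← pow_add]
    have h1 := Yc_congr ℓ V α l (nt x) hl
    have h2 : (ℓ : ℤ) ^ V ∣ ((x0 + ℓ ^ m * U x : ℕ) : ℤ) - ((∑ i, nt x i * l i : ℕ) : ℤ) := by
      have := hzx x
      rw [hU x] at this
      exact_mod_cast this
    have h3 := gamma_congr ℓ V _ _ h2
    have := dvd_sub h1 h3
    simpa using this
  · obtain ⟨u, hu, _⟩ := gamma_pow ℓ m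
    exact ⟨u, by rw [hu]; ring⟩
  · exact gamma_not_dvd ℓ x0
  · intro x y h1 h2
    have h3 := hQ2 (nt x) ⟨x.1, rfl⟩ (nt y) ⟨y.1, rfl⟩ h1 h2
    apply Subtype.ext
    funext i
    apply Fin.ext
    exact congrFun h3 i
end

end

section

section
open Module
variable {κ E : Type} [Fintype κ] [DecidableEq κ] [Fintype E] (X : E → κ → ℤ) (Y : E → ℤ)

lemma prodX_bound (β T : ℕ) (hX : ∀ x i, |X x i| ≤ 2 ^ β) (τ : κ → ℕ) (x : E)
    (hτ : ∑ i, τ i ≤ T) : |∏ i, X x i ^ τ i| ≤ 2 ^ (β * T) := by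
  rw [Finset.abs_prod]
  calc ∏ i, |X x i ^ τ i| ≤ ∏ i, (2 : ℤ) ^ (β * τ i) := by
        refine Finset.prod_le_prod (fun i _ => abs_nonneg _) (fun i _ => ?_)
        rw [abs_pow, pow_mul]
        exact pow_le_pow_left₀ (abs_nonneg _) (hX x i) _
    _ = 2 ^ (β * ∑ i, τ i) := by rw [Finset.prod_pow_eq_pow_sum, Finset.mul_sum]
    _ ≤ _ := pow_le_pow_right₀ (by norm_num) (Nat.mul_le_mul_left _ hτ)

lemma chain_all (ℓ : ℕ) [Fact ℓ.Prime] (k n P P' ρ h b V β : ℕ) (hk : 5 ≤ k) (hn : 1 ≤ n)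
    (hP : P = k * P') (hP'1 : 1 ≤ P') (hρ : 1 ≤ ρ) (hh : h = 4 * ρ * n * P') (hb : b = n * P)
    (hβ : β = 2 ^ (k - 4))
    (hV : h * ((k + 1) * ((2 * ρ) ^ k * h) + h * h + h * (2 * ρ) ^ k * (2 * ρ) ^ k +
      (2 * ρ) ^ k + 1) ≤ V)
    (B0 c : ℤ) (hB0 : (ℓ : ℤ) ^ (k + 2) ∣ B0 - 1) (hc : ¬ (ℓ : ℤ) ∣ c)
    (u0 : ℚ) (u : κ → ℚ) (U : E → ℕ) (hU : ∀ x, (U x : ℚ) = u0 + ∑ i, u i * X x i)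
    (hY : ∀ x, (ℓ : ℤ) ^ V ∣ Y x - c * B0 ^ (U x))
    (hX : ∀ x i, |X x i| ≤ 2 ^ β) (hYb : ∀ x, |Y x| ≤ 2 ^ b) (hE : Fintype.card E ≤ 2 ^ b)
    (j : ℕ) (hj : j ≤ k) :
    finrank ℚ (VS X Y (2 * k * h - j * h) (ρ ^ j * 2 ^ k)) ≤
      2 ^ j * finrank ℚ (VS X Y (2 * k * h) (2 ^ k)) := by
  have hℓ : ℓ.Prime := Fact.out
  induction j with
  | zero => rw [Nat.zero_mul, Nat.sub_zero, pow_zero, one_mul, pow_zero, one_mul]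
  | succ j ih =>
    have ih' := ih (by omega)
    have hSj : ρ ^ j * 2 ^ k ≤ (2 * ρ) ^ k := by
      rw [mul_pow, mul_comm]
      exact Nat.mul_le_mul_left _ (Nat.pow_le_pow_right hρ (by omega))
    have hstep := chain_step X Y ℓ k
      ((k + 1) * ((ρ ^ j * 2 ^ k) * h) + h * h + h * (ρ ^ j * 2 ^ k) * (ρ ^ j * 2 ^ k) +
        (ρ ^ j * 2 ^ k))
      (ρ ^ j * 2 ^ k) h ((k + 1) * ((ρ ^ j * 2 ^ k) * h)) V (2 * k * h - (j + 1) * h)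
      (ρ ^ (j + 1) * 2 ^ k) (2 ^ (β * (2 * k * h) + b * (ρ ^ (j + 1) * 2 ^ k)))
      (by subst hh; have : 0 < 4 * ρ * n * P' := by positivity
          omega) rfl le_rfl (by
        refine le_trans ?_ hV
        gcongr) B0 c hB0 hc u0 u U hU hY
      (by
        calc 2 = 2 ^ 1 := rfl
          _ ≤ _ := by
            refine Nat.pow_le_pow_right (by norm_num) ?_
            have : 0 < b * (ρ ^ (j + 1) * 2 ^ k) := by subst hb; subst hP; positivity
            omega)
      (by
        rintro ⟨⟨τ, s⟩, hτ, hs⟩ x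
        simp only at hτ hs
        simp only [monFun]
        rw [abs_mul]
        push_cast
        rw [pow_add]
        refine mul_le_mul (prodX_bound X β _ hX τ x (by omega)) ?_ (abs_nonneg _) (by positivity)
        rw [abs_pow]
        calc |Y x| ^ s ≤ (2 ^ b) ^ s := pow_le_pow_left₀ (abs_nonneg _) (hYb x) _
          _ = 2 ^ (b * s) := by rw [pow_mul]
          _ ≤ _ := pow_le_pow_right₀ (by norm_num) (Nat.mul_le_mul_left _ hs.le))
      (by
        calc _ ≤ (2 ^ b * 2 ^ (β * (2 * k * h) + b * (ρ ^ (j + 1) * 2 ^ k))) ^ 2 := by gcongr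
          _ = 2 ^ (2 * (b + (β * (2 * k * h) + b * (ρ ^ (j + 1) * 2 ^ k)))) := by
              rw [← pow_add, ← pow_mul, mul_comm]
          _ ≤ 2 ^ ((k + 1) * ((ρ ^ j * 2 ^ k) * h)) := by
              refine Nat.pow_le_pow_right (by norm_num) ?_
              have e1 : k * h = 4 * ρ * b := by rw [hh, hb, hP]; ring
              have e2 : β * 16 = 2 ^ k := by
                rw [hβ]
                calc 2 ^ (k - 4) * 16 = 2 ^ (k - 4) * 2 ^ 4 := by norm_num
                  _ = 2 ^ (k - 4 + 4) := by rw [pow_add]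
                  _ = _ := by congr 1; omega
              set s := ρ ^ j * 2 ^ k with hs
              have e3 : ρ ^ (j + 1) * 2 ^ k = ρ * s := by rw [hs]; ring
              have e4 : 2 ^ k ≤ s := by
                rw [hs]; exact Nat.le_mul_of_pos_left _ (by positivity)
              have e5 : 2 ≤ s := le_trans (by
                calc 2 = 2 ^ 1 := rfl
                  _ ≤ 2 ^ k := Nat.pow_le_pow_right (by norm_num) (by omega)) e4
              rw [e3]
              have e6 : β * (2 * k * h) * 2 = ρ * b * 2 ^ k := by
                rw [← e2]
                calc β * (2 * k * h) * 2 = β * 4 * (k * h) := by ring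
                  _ = _ := by rw [e1]; ring
              have e7 : k * (s * h) = 4 * ρ * b * s := by
                calc k * (s * h) = (k * h) * s := by ring
                  _ = _ := by rw [e1]
              have e8 : ρ * b * 2 ^ k ≤ ρ * b * s := Nat.mul_le_mul_left _ e4
              have e9 : b * 2 ≤ ρ * b * s := by
                calc b * 2 ≤ b * s := Nat.mul_le_mul_left _ e5
                  _ ≤ ρ * (b * s) := Nat.le_mul_of_pos_left _ (by omega)
                  _ = _ := by ring
              have e10 : (k + 1) * (s * h) = 4 * ρ * b * s + s * h := by rw [← e7]; ring
              rw [e10]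
              have e11 : b * (ρ * s) = ρ * b * s := by ring
              have e12 : 4 * ρ * b * s = 4 * (ρ * b * s) := by ring
              rw [e11, e12]
              have : 0 ≤ s * h := Nat.zero_le _
              omega
          _ ≤ _ := Nat.pow_le_pow_left hℓ.two_le _)
    have e : 2 * k * h - (j + 1) * h + h = 2 * k * h - j * h := by
      have : (j + 1) * h ≤ 2 * k * h := Nat.mul_le_mul_right _ (by omega)
      have : (j + 1) * h = j * h + h := by ring
      omega
    rw [e] at hstep
    calc _ ≤ _ := hstep
      _ ≤ 2 * (2 ^ j * finrank ℚ (VS X Y (2 * k * h) (2 ^ k))) := by gcongr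
      _ = _ := by ring

lemma choose_bound (ρ n P T d : ℕ) (hn : 1 ≤ n) (hd : d + 1 = n) (hT : T + d ≤ 9 * ρ * n * P) :
    (T + d).choose d ≤ (9 * ρ * P) ^ d * 3 ^ n := by
  have h1 : n ^ n ≤ 3 ^ n * n.factorial := by
    have h2 := Real.pow_div_factorial_le_exp (n : ℝ) (by positivity) n
    rw [div_le_iff₀ (by positivity)] at h2
    have h3 : Real.exp n ≤ 3 ^ n := by
      rw [← Real.exp_one_pow]
      exact pow_le_pow_left₀ (Real.exp_pos _).le (by linarith [Real.exp_one_lt_d9]) _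
    have h4 : (n : ℝ) ^ n ≤ 3 ^ n * n.factorial :=
      h2.trans (by gcongr)
    exact_mod_cast h4
  have h5 : (T + d).choose d * d.factorial ≤ (T + d) ^ d := by
    rw [mul_comm, ← Nat.descFactorial_eq_factorial_mul_choose]
    exact Nat.descFactorial_le_pow _ _
  have h6 : (T + d).choose d * n.factorial ≤ ((9 * ρ * P) ^ d * 3 ^ n) * n.factorial := by
    calc (T + d).choose d * n.factorial = ((T + d).choose d * d.factorial) * n := by
          rw [← hd, Nat.factorial_succ]; ring
      _ ≤ (9 * ρ * n * P) ^ d * n := by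
          gcongr
          exact h5.trans (Nat.pow_le_pow_left hT _)
      _ = (9 * ρ * P) ^ d * n ^ n := by
          have : n ^ n = n ^ d * n := by rw [← pow_succ, hd]
          rw [this]; ring
      _ ≤ (9 * ρ * P) ^ d * (3 ^ n * n.factorial) := by gcongr
      _ = _ := by ring
  exact Nat.le_of_mul_le_mul_right h6 (Nat.factorial_pos n)
end

end

section

section
open Module

lemma sq_le_two_pow (t : ℕ) : (t + 16) ^ 2 + 5 * (t + 16) + 2 ≤ 2 ^ (t + 11) := by
  induction t with
  | zero => norm_num
  | succ t ih =>
    have : 2 ^ (t + 1 + 11) = 2 * 2 ^ (t + 11) := by ring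
    rw [this]; nlinarith

lemma V_bound (k n ℓ ρ P' h S : ℕ) (hk : 16 ≤ k) (hℓ : 2 ≤ ℓ) (hρ : ρ = 2 ^ 60 * ℓ ^ 8)
    (hn : n ≤ 2 ^ k) (hP' : P' = ℓ ^ k * 2 ^ (4 * k + 1)) (hh : h = 4 * ρ * n * P')
    (hS : S = (2 * ρ) ^ k) :
    h * ((k + 1) * (S * h) + h * h + h * S * S + S + 1) ≤ (2 * ρ) ^ (5 * k) := by
  have hρ1 : 1 ≤ ρ := by rw [hρ]; exact Nat.one_le_iff_ne_zero.mpr (by positivity)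
  have h1 : h ≤ S := by
    rw [hh, hS, hP']
    obtain ⟨t, rfl⟩ := Nat.exists_eq_add_of_le hk
    calc 4 * ρ * n * (ℓ ^ (16 + t) * 2 ^ (4 * (16 + t) + 1))
        ≤ 4 * ρ * 2 ^ (16 + t) * (ℓ ^ (16 + t) * 2 ^ (4 * (16 + t) + 1)) := by gcongr
      _ = ρ * (ℓ ^ (15 + t) * 2 ^ (3 + 5 * (16 + t)) * ℓ) := by ring
      _ ≤ ρ * (ℓ ^ (15 + t) * 2 ^ (3 + 5 * (16 + t)) * ℓ ^ 1) := by simp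
      _ ≤ ρ * (ℓ ^ (8 * (15 + t)) * 2 ^ (61 * (15 + t) + 1)) := by
          have e : ℓ ^ (15 + t) * 2 ^ (3 + 5 * (16 + t)) * ℓ ^ 1
            = ℓ ^ (16 + t) * 2 ^ (3 + 5 * (16 + t)) := by ring
          rw [e]
          refine Nat.mul_le_mul_left _ (Nat.mul_le_mul ?_ ?_)
          · exact Nat.pow_le_pow_right (by omega) (by omega)
          · exact Nat.pow_le_pow_right (by omega) (by omega)
      _ = 2 * ρ * (2 * (2 ^ 60 * ℓ ^ 8)) ^ (15 + t) := by
          rw [mul_pow, mul_pow, ← pow_mul, ← pow_mul]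
          have : ∀ u, 2 ^ (61 * u + 1) = 2 * 2 ^ u * 2 ^ (60 * u) := by intro u; ring
          rw [this]; ring
      _ = _ := by rw [← hρ]; ring
  have h2 : k + 1 ≤ S := by
    rw [hS]
    calc k + 1 ≤ 2 ^ k := Nat.lt_two_pow_self
      _ ≤ _ := Nat.pow_le_pow_left (by omega) _
  have h3 : 5 ≤ S := by omega
  calc h * ((k + 1) * (S * h) + h * h + h * S * S + S + 1)
      ≤ S * (S * (S * S) + S * S + S * S * S + S + 1) := by gcongr
    _ ≤ S ^ 5 := by
        have a1 : S * S ≤ S * S * S := Nat.le_mul_of_pos_right _ (by omega)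
        have a2 : S ≤ S * S := Nat.le_mul_of_pos_right _ (by omega)
        have a3 : S * (S * (S * S) + S * S + S * S * S + S + 1) ≤ S * (5 * (S * S * S)) := by
          refine Nat.mul_le_mul_left _ ?_
          have : S * (S * S) = S * S * S := by ring
          omega
        calc _ ≤ _ := a3
          _ ≤ S * (S * (S * S * S)) := by gcongr
          _ = _ := by ring
    _ = _ := by rw [hS, ← pow_mul, mul_comm k]

lemma final_num (k n ℓ ρ P' P b β Q g : ℕ) (hk : 16 ≤ k) (hℓ : 2 ≤ ℓ) (hρ : ρ = 2 ^ 60 * ℓ ^ 8)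
    (hn : n ≤ 2 ^ k) (hP' : P' = ℓ ^ k * 2 ^ (4 * k + 1)) (hP : P = k * P') (hb : b = n * P)
    (hβ : 16 * β = 2 ^ k) (hQ : Q ≤ 16 * (P * b)) (hg : g = 2 * b * (1 + 4 * ρ * β)) :
    g * g * Q ≤ ρ ^ k * 2 ^ k := by
  have hρ1 : 1 ≤ ρ := by rw [hρ]; exact Nat.one_le_iff_ne_zero.mpr (by positivity)
  have hk2 : k ≤ 2 ^ k := Nat.lt_two_pow_self.le
  have hP1 : P ≤ ℓ ^ k * 2 ^ (5 * k + 1) := by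
    rw [hP, hP']
    calc k * (ℓ ^ k * 2 ^ (4 * k + 1)) ≤ 2 ^ k * (ℓ ^ k * 2 ^ (4 * k + 1)) := by gcongr
      _ = _ := by ring
  have hb1 : b ≤ ℓ ^ k * 2 ^ (6 * k + 1) := by
    rw [hb]
    calc n * P ≤ 2 ^ k * (ℓ ^ k * 2 ^ (5 * k + 1)) := by gcongr
      _ = _ := by ring
  have hβ1 : 1 + 4 * ρ * β ≤ ρ * 2 ^ k := by
    rw [← hβ]
    have : 1 ≤ β := by
      by_contra h
      have : β = 0 := by omega
      rw [this] at hβ; have := Nat.pow_pos (n := k) (show 0 < 2 by norm_num); omega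
    nlinarith
  have hg1 : g ≤ ℓ ^ k * 2 ^ (7 * k + 2) * ρ := by
    rw [hg]
    calc 2 * b * (1 + 4 * ρ * β) ≤ 2 * (ℓ ^ k * 2 ^ (6 * k + 1)) * (ρ * 2 ^ k) := by gcongr
      _ = _ := by ring
  have hQ1 : Q ≤ ℓ ^ (2 * k) * 2 ^ (11 * k + 6) := by
    calc Q ≤ 16 * (P * b) := hQ
      _ ≤ 16 * ((ℓ ^ k * 2 ^ (5 * k + 1)) * (ℓ ^ k * 2 ^ (6 * k + 1))) := by gcongr
      _ = _ := by ring
  calc g * g * Q ≤ (ℓ ^ k * 2 ^ (7 * k + 2) * ρ) * (ℓ ^ k * 2 ^ (7 * k + 2) * ρ) *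
        (ℓ ^ (2 * k) * 2 ^ (11 * k + 6)) := by gcongr
    _ = ρ ^ 2 * (ℓ ^ (4 * k) * 2 ^ (25 * k + 10)) := by ring
    _ ≤ ρ ^ 2 * (ℓ ^ (8 * (k - 2)) * 2 ^ (60 * (k - 2) + k)) := by
        refine Nat.mul_le_mul_left _ (Nat.mul_le_mul ?_ ?_)
        · exact Nat.pow_le_pow_right (by omega) (by omega)
        · exact Nat.pow_le_pow_right (by omega) (by omega)
    _ = ρ ^ 2 * ((2 ^ 60 * ℓ ^ 8) ^ (k - 2) * 2 ^ k) := by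
        rw [mul_pow, ← pow_mul, ← pow_mul, pow_add]; ring
    _ = _ := by
        rw [← hρ, ← mul_assoc, ← pow_add]; congr 2; omega

set_option maxHeartbeats 1000000 in
theorem thmG {ι : Type} [Fintype ι] [DecidableEq ι] (i0 : ι)
    (α a : ι → ℕ) (ha1 : ∀ i, 1 ≤ a i)
    (hα : ∀ i, α i ≤ 2 ^ a i) (hα1 : ∀ i, 1 ≤ α i)
    (hinj : ∀ x y : ι → ℕ, Yc α x = Yc α y → x = y)
    (ℓ : ℕ) [Fact ℓ.Prime] (k V : ℕ) (l : ι → ℕ)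
    (hl : ∀ i, (ℓ : ℤ) ^ V ∣ (α i : ℤ) - (1 + (ℓ : ℤ) ^ 2) ^ l i)
    (e : ι → ℤ) (he0 : ¬ (ℓ : ℤ) ∣ e i0) (hel : (ℓ : ℤ) ^ V ∣ ∑ i, e i * (l i : ℤ))
    (B : ℕ) (hB : ∀ i, |e i| ≤ B) (hBk : B ≤ 2 ^ 2 ^ (k - 5))
    (ha : ∏ i, (2 * a i) ≤ 2 ^ k)
    (hρk : (27 * (2 ^ 60 * ℓ ^ 8)) ^ (Fintype.card ι) ≤ 2 ^ k) :
    V < (2 * (2 ^ 60 * ℓ ^ 8)) ^ (5 * k) := by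
  by_contra hV
  push Not at hV
  have hℓ : ℓ.Prime := Fact.out
  have hℓ2 := hℓ.two_le
  obtain ⟨ρ, hρ⟩ : ∃ ρ, ρ = 2 ^ 60 * ℓ ^ 8 := ⟨_, rfl⟩
  rw [← hρ] at hV hρk
  obtain ⟨n, hn⟩ : ∃ n, n = Fintype.card ι := ⟨_, rfl⟩
  rw [← hn] at hρk
  have hn1 : 1 ≤ n := by rw [hn]; exact Fintype.card_pos_iff.mpr ⟨i0⟩
  have hℓ8 : ℓ ≤ ℓ ^ 8 := Nat.le_self_pow (by norm_num) _
  have hρℓ : 2 ^ 60 * ℓ ≤ ρ := by rw [hρ]; gcongr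
  have hρ60 : 2 ^ 60 ≤ ρ := le_trans (Nat.le_mul_of_pos_right _ (by omega)) hρℓ
  have hρ1k : 27 * ρ ≤ 2 ^ k := le_trans (Nat.le_self_pow (by omega) _) hρk
  have hℓk : ℓ ≤ 2 ^ k := by omega
  have hk : 16 ≤ k := by
    by_contra h
    have : 2 ^ k ≤ 2 ^ 16 := Nat.pow_le_pow_right (by norm_num) (by omega)
    norm_num at this hρ60
    omega
  have hnk : n ≤ 2 ^ k := by
    calc n ≤ 2 ^ n := Nat.lt_two_pow_self.le
      _ ≤ (27 * ρ) ^ n := Nat.pow_le_pow_left (by omega) _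
      _ ≤ _ := hρk
  obtain ⟨P', hP'⟩ : ∃ P', P' = ℓ ^ k * 2 ^ (4 * k + 1) := ⟨_, rfl⟩
  obtain ⟨P, hP⟩ : ∃ P, P = k * P' := ⟨_, rfl⟩
  obtain ⟨h, hh⟩ : ∃ h, h = 4 * ρ * n * P' := ⟨_, rfl⟩
  obtain ⟨b, hb⟩ : ∃ b, b = n * P := ⟨_, rfl⟩
  obtain ⟨β, hβ⟩ : ∃ β, β = 2 ^ (k - 4) := ⟨_, rfl⟩
  have hP'1 : 2 ^ (4 * k + 1) ≤ P' := by
    rw [hP']; exact Nat.le_mul_of_pos_left _ (by positivity)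
  have hPP' : P' ≤ P := by rw [hP]; exact Nat.le_mul_of_pos_left _ (by omega)
  have hPk : 2 ^ (4 * k + 1) ≤ P := hP'1.trans hPP'
  have hP'0 : 1 ≤ P' := le_trans Nat.one_le_two_pow hP'1
  have haP : ∀ i, a i ≤ P := by
    intro i
    have h1 : 2 * a i ≤ ∏ i, (2 * a i) :=
      Finset.single_le_prod' (f := fun i => 2 * a i) (fun i _ => by have := ha1 i; omega)
        (Finset.mem_univ i)
    have h2 : 2 ^ k ≤ 2 ^ (4 * k + 1) := Nat.pow_le_pow_right (by norm_num) (by omega)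
    omega
  have hPle : 2 * P ≤ 2 ^ (k ^ 2 + 5 * k + 2) := by
    rw [hP, hP']
    calc 2 * (k * (ℓ ^ k * 2 ^ (4 * k + 1)))
        ≤ 2 * (2 ^ k * ((2 ^ k) ^ k * 2 ^ (4 * k + 1))) := by
          gcongr
          exact Nat.lt_two_pow_self.le
      _ = _ := by ring
  have hβ16 : 16 * β = 2 ^ k := by
    rw [hβ]
    calc 16 * 2 ^ (k - 4) = 2 ^ (4 + (k - 4)) := by rw [pow_add]; norm_num
      _ = _ := by congr 1; omega
  have hβ5 : β = 2 * 2 ^ (k - 5) := by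
    rw [hβ, ← pow_succ']; congr 1; omega
  have hkk : k ^ 2 + 5 * k + 2 ≤ 2 ^ (k - 5) := by
    have := sq_le_two_pow (k - 16)
    have e1 : k - 16 + 16 = k := by omega
    have e2 : k - 16 + 11 = k - 5 := by omega
    rwa [e1, e2] at this
  have hBP2 : 2 * B * P ≤ 2 ^ β := by
    calc 2 * B * P = B * (2 * P) := by ring
      _ ≤ 2 ^ 2 ^ (k - 5) * 2 ^ (2 ^ (k - 5)) := by
          refine Nat.mul_le_mul hBk (hPle.trans (Nat.pow_le_pow_right (by norm_num) hkk))
      _ = _ := by rw [← pow_add, hβ5, two_mul]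
  have h2k5 : 2 ^ (k - 5) ≤ 2 ^ (4 * k + 1) := Nat.pow_le_pow_right (by norm_num) (by omega)
  have hBP : B ≤ 2 ^ (2 * P) := hBk.trans (Nat.pow_le_pow_right (by norm_num) (by omega))
  have hP12 : 2 ^ 12 ≤ P := le_trans (Nat.pow_le_pow_right (by norm_num) (by omega)) hPk
  have hVb := V_bound k n ℓ ρ P' h ((2 * ρ) ^ k) hk hℓ2 hρ hnk hP' hh rfl
  have hkV : k ≤ V := by
    refine le_trans ?_ hV
    calc k ≤ 2 ^ k := Nat.lt_two_pow_self.le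
      _ ≤ 2 ^ (5 * k) := Nat.pow_le_pow_right (by norm_num) (by omega)
      _ ≤ _ := Nat.pow_le_pow_left (by omega) _
  obtain ⟨E, _, X, Y, U, u0, u, B0, c, N, Q, hE1, hE2, hY1, hX1, hU, hYV, hB0, hc, hN, hN32, hQ,
    hQ16, hXY⟩ := Gsetup i0 α a P ha1 haP hα hα1 hinj ℓ k V hkV l hl e he0 hel B hB hBP hP12
  rw [← hn, ← hb] at hQ16
  rw [← hn, ← hb] at hY1
  have hX2 : ∀ x i, |X x i| ≤ 2 ^ β := fun x i => (hX1 x i).trans (by exact_mod_cast hBP2)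
  have hYb : ∀ x, |Y x| ≤ 2 ^ b := by
    intro x
    have := hY1 x
    rw [abs_of_nonneg (by linarith [this.1])]
    exact this.2
  have hEb : Fintype.card E ≤ 2 ^ b := by
    calc Fintype.card E ≤ ∏ i, (P / a i) := hE2
      _ ≤ ∏ i : ι, 2 ^ P :=
          Finset.prod_le_prod' (fun i _ => (Nat.div_le_self _ _).trans Nat.lt_two_pow_self.le)
      _ = _ := by rw [Finset.prod_const, Finset.card_univ, ← hn, ← pow_mul, hb, mul_comm]
  have hchain := chain_all X Y ℓ k n P P' ρ h b V β (by omega) hn1 hP hP'0 (by omega) hh hb hβ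
    (hVb.trans hV) B0 c hB0 hc u0 u U hU hYV hX2 hYb hEb k le_rfl
  have hkh : k * h = 4 * ρ * b := by rw [hh, hb, hP]; ring
  have hT2 : 2 * k * h - k * h = 4 * ρ * b := by
    have : 2 * k * h = 2 * (k * h) := by ring
    rw [this, hkh]; omega
  rw [hT2] at hchain
  have hκ : Fintype.card {i : ι // i ≠ i0} + 1 = n := by
    have h1 : Fintype.card {i : ι // i ≠ i0} = Fintype.card ι - 1 := by
      rw [Fintype.card_subtype_compl]; simp
    omega
  obtain ⟨d, hd⟩ : ∃ d, d = Fintype.card {i : ι // i ≠ i0} := ⟨_, rfl⟩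
  rw [← hd] at hκ
  have hb1 : 1 ≤ b := by
    rw [hb]; exact Nat.one_le_iff_ne_zero.mpr (Nat.mul_ne_zero (by omega) (by omega))
  have hβ1 : 1 ≤ β := by rw [hβ]; exact Nat.one_le_two_pow
  have : Fact N.Prime := ⟨hN⟩
  have : Fact Q.Prime := ⟨hQ⟩
  have hfin := final_lower X Y N Q (2 * b * (1 + 4 * ρ * β)) (4 * ρ * b) (ρ ^ k * 2 ^ k)
    (2 ^ (β * (4 * ρ * b))) hXY
    (by
      rw [← hd]
      calc d * (N - 1) ≤ n * (32 * P) := Nat.mul_le_mul (by omega) (by omega)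
        _ = 32 * b := by rw [hb]; ring
        _ ≤ _ := by gcongr; omega)
    (by
      have h1 := final_num k n ℓ ρ P' P b β Q _ hk hℓ2 hρ hnk hP' hP hb hβ16 hQ16 rfl
      refine lt_of_lt_of_le ?_ h1
      have : 0 < 2 * b * (1 + 4 * ρ * β) * (2 * b * (1 + 4 * ρ * β)) := by positivity
      exact Nat.mul_lt_mul_of_pos_left (by have := hQ.two_le; omega) this)
    (by
      calc 2 = 2 ^ 1 := rfl
        _ ≤ _ := by
          refine Nat.pow_le_pow_right (by norm_num) ?_
          have : 0 < β * (4 * ρ * b) := by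
            have : 0 < ρ := by omega
            positivity
          omega)
    (by
      intro τ x hτ
      push_cast
      exact prodX_bound X β _ hX2 τ x hτ)
    (by
      calc _ ≤ (2 ^ b * 2 ^ (β * (4 * ρ * b))) ^ 2 := by gcongr
        _ = 2 ^ (2 * b * (1 + 4 * ρ * β)) := by
            rw [← pow_add, ← pow_mul]; congr 1; ring
        _ ≤ _ := Nat.pow_le_pow_left hQ.two_le _)
  have hdim := finrank_VS_le X Y (2 * k * h) (2 ^ k)
  rw [← hd] at hdim
  have hT0 : 2 * k * h = 8 * ρ * n * P := by
    have : 2 * k * h = 2 * (k * h) := by ring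
    rw [this, hkh, hb]; ring
  have hchoose := choose_bound ρ n P (2 * k * h) d hn1 hκ (by
    rw [hT0]
    have : n ≤ ρ * n * P := by
      calc n = 1 * n * 1 := by ring
        _ ≤ _ := by gcongr <;> omega
    have e1 : 8 * ρ * n * P = 8 * (ρ * n * P) := by ring
    have e2 : 9 * ρ * n * P = 9 * (ρ * n * P) := by ring
    omega)
  have hcard : Fintype.card E ≤ 2 ^ (3 * k + 1) * P ^ d := by
    calc Fintype.card E ≤ 2 * (2 ^ k * (2 ^ k * ((9 * ρ * P) ^ d * 3 ^ n))) := by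
          refine hfin.trans (Nat.mul_le_mul_left _ (hchain.trans (Nat.mul_le_mul_left _
            (hdim.trans (Nat.mul_le_mul_left _ hchoose)))))
      _ = 2 ^ (2 * k + 1) * (P ^ d * ((9 * ρ) ^ d * 3 ^ n)) := by ring
      _ ≤ 2 ^ (2 * k + 1) * (P ^ d * ((9 * ρ) ^ n * 3 ^ n)) := by
          gcongr <;> omega
      _ = 2 ^ (2 * k + 1) * (P ^ d * (27 * ρ) ^ n) := by rw [← mul_pow]; congr 3; ring
      _ ≤ 2 ^ (2 * k + 1) * (P ^ d * 2 ^ k) := by gcongr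
      _ = _ := by ring
  have hlow : P ^ n ≤ 2 ^ k * ∏ i, (P / a i) := by
    calc P ^ n = ∏ _i : ι, P := by rw [Finset.prod_const, Finset.card_univ, hn]
      _ ≤ ∏ i, (2 * a i * (P / a i)) := by
          refine Finset.prod_le_prod' (fun i _ => ?_)
          have h1 := Nat.div_add_mod P (a i)
          have h2 := Nat.mod_lt P (show a i > 0 from ha1 i)
          have h3 : 1 ≤ P / a i := (Nat.one_le_div_iff (ha1 i)).mpr (haP i)
          have h4 : a i ≤ a i * (P / a i) := Nat.le_mul_of_pos_right _ h3
          have h5 : 2 * a i * (P / a i) = 2 * (a i * (P / a i)) := by ring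
          omega
      _ = (∏ i, (2 * a i)) * ∏ i, (P / a i) := Finset.prod_mul_distrib
      _ ≤ _ := by gcongr
  have hfinal : P * P ^ d ≤ P' * P ^ d := by
    calc P * P ^ d = P ^ n := by rw [← hκ, pow_succ, mul_comm]
      _ ≤ 2 ^ k * (2 ^ (3 * k + 1) * P ^ d * ℓ ^ k) :=
          hlow.trans (Nat.mul_le_mul_left _ (hE1.trans (Nat.mul_le_mul_right _ hcard)))
      _ = (ℓ ^ k * 2 ^ (4 * k + 1)) * P ^ d := by ring
      _ = _ := by rw [← hP']
  have hfinal2 : P ≤ P' := Nat.le_of_mul_le_mul_right hfinal (Nat.pow_pos (by omega))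
  rw [hP] at hfinal2
  nlinarith
end

end

section

section

lemma strip_val {ι : Type} (ℓ : ℕ) (hℓ : ℓ.Prime) (i1 : ι) (M : ℕ) : ∀ (e : ι → ℤ), e i1 ≠ 0 →
    (e i1).natAbs ≤ M → ∃ (s : ℕ) (e' : ι → ℤ) (i0 : ι), (∀ i, e i = (ℓ : ℤ) ^ s * e' i) ∧
      ¬ (ℓ : ℤ) ∣ e' i0 := by
  induction M with
  | zero => intro e h1 h2; omega
  | succ M ih =>
    intro e h1 h2
    by_cases hall : ∀ i, (ℓ : ℤ) ∣ e i
    · choose f hf using hall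
      have hf1 : f i1 ≠ 0 := by intro h; rw [hf, h] at h1; simp at h1
      have hlt : (f i1).natAbs ≤ M := by
        have h3 : (e i1).natAbs = ℓ * (f i1).natAbs := by rw [hf, Int.natAbs_mul]; simp
        have h4 : 0 < (f i1).natAbs := Int.natAbs_pos.mpr hf1
        have := hℓ.two_le
        nlinarith
      obtain ⟨s, e', i0, h5, h6⟩ := ih f hf1 hlt
      exact ⟨s + 1, e', i0, fun i => by rw [hf, h5]; ring, h6⟩
    · push Not at hall
      obtain ⟨i0, hi0⟩ := hall
      exact ⟨0, e, i0, by simp, hi0⟩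

lemma Yc_primes (S : Finset ℕ) (φ : ℕ) (x : ℕ) (hx : x ≠ 0) (hS : x.primeFactors ⊆ S) :
    Yc (fun p : {p // p ∈ S} => (p : ℕ) ^ φ) (fun p => x.factorization p) = x ^ φ := by
  unfold Yc
  have h1 : ∏ p : {p // p ∈ S}, ((p : ℕ) ^ φ) ^ x.factorization p =
      ∏ p ∈ S, (p ^ φ) ^ x.factorization p :=
    Finset.prod_coe_sort S (fun p => (p ^ φ) ^ x.factorization p)
  rw [h1]
  conv_rhs => rw [← Nat.prod_factorization_pow_eq_self hx]
  rw [Finsupp.prod, ← Finset.prod_pow]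
  rw [Nat.support_factorization]
  symm
  have h2 : ∀ p, (p ^ φ) ^ x.factorization p = (p ^ x.factorization p) ^ φ := fun p => by
    rw [← pow_mul, ← pow_mul, mul_comm]
  simp only [h2]
  refine Finset.prod_subset hS (fun p _ hp => ?_)
  rw [← Nat.support_factorization, Finsupp.notMem_support_iff] at hp
  rw [hp]; simp

lemma Yc_primes_inj (S : Finset ℕ) (hS : ∀ p ∈ S, p.Prime) (φ : ℕ) (hφ : 1 ≤ φ)
    (x y : {p // p ∈ S} → ℕ)
    (h : Yc (fun p : {p // p ∈ S} => (p : ℕ) ^ φ) x = Yc (fun p : {p // p ∈ S} => (p : ℕ) ^ φ) y) :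
    x = y := by
  have key : ∀ (z : {p // p ∈ S} → ℕ) (q : {p // p ∈ S}),
      (Yc (fun p : {p // p ∈ S} => (p : ℕ) ^ φ) z).factorization q = φ * z q := by
    intro z q
    unfold Yc
    rw [Nat.factorization_prod (fun (p : {p // p ∈ S}) _ =>
      pow_ne_zero _ (pow_ne_zero _ (hS p.1 p.2).ne_zero))]
    rw [Finset.sum_apply', Finset.sum_eq_single q]
    · rw [← pow_mul, Nat.Prime.factorization_pow (hS q q.2)]; simp
    · intro p _ hpq
      rw [← pow_mul, Nat.Prime.factorization_pow (hS p p.2), Finsupp.single_apply_eq_zero]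
      intro h; exact absurd (Subtype.ext h.symm) hpq
    · simp
  funext q
  have := key x q
  rw [h, key y q] at this
  exact (Nat.eq_of_mul_eq_mul_left (by omega) this).symm

theorem thmH (ℓ : ℕ) [Fact ℓ.Prime] (x y v k D : ℕ) (hx : x ≠ 0) (hy : y ≠ 0)
    (hxy : Nat.Coprime x y) (hne : x * y ≠ 1) (hℓ' : ¬ ℓ ∣ x * y)
    (hv : (ℓ : ℤ) ^ v ∣ (x : ℤ) ^ 2 - (y : ℤ) ^ 2)
    (hxD : x < 2 ^ D) (hyD : y < 2 ^ D) (hDk : D ≤ 2 ^ 2 ^ (k - 5))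
    (hk1 : ∏ p ∈ (x * y).primeFactors, (2 * (ℓ ^ 2 * (Nat.log 2 p + 1))) ≤ 2 ^ k)
    (hk2 : (27 * (2 ^ 60 * ℓ ^ 8)) ^ ((x * y).primeFactors.card) ≤ 2 ^ k) :
    v < 2 * (2 * (2 ^ 60 * ℓ ^ 8)) ^ (5 * k) := by
  by_contra hcon
  push Not at hcon
  have hℓ : ℓ.Prime := Fact.out
  have hℓ2 := hℓ.two_le
  have hxy0 : x * y ≠ 0 := Nat.mul_ne_zero hx hy
  obtain ⟨S, hSdef⟩ : ∃ S, S = (x * y).primeFactors := ⟨_, rfl⟩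
  rw [← hSdef] at hk1 hk2
  have hSp : ∀ p ∈ S, p.Prime := fun p hp => by
    rw [hSdef] at hp; exact Nat.prime_of_mem_primeFactors hp
  have hSx : x.primeFactors ⊆ S := by
    rw [hSdef, Nat.primeFactors_mul hx hy]; exact Finset.subset_union_left
  have hSy : y.primeFactors ⊆ S := by
    rw [hSdef, Nat.primeFactors_mul hx hy]; exact Finset.subset_union_right
  have hpl : ∀ p ∈ S, Nat.Coprime p ℓ := fun p hp => by
    rw [hSdef] at hp
    refine (Nat.coprime_primes (Nat.prime_of_mem_primeFactors hp) hℓ).mpr ?_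
    rintro rfl
    exact hℓ' (Nat.dvd_of_mem_primeFactors hp)
  obtain ⟨φ, hφ⟩ : ∃ φ, φ = ℓ * (ℓ - 1) := ⟨_, rfl⟩
  have hφ1 : 1 ≤ φ := by
    rw [hφ]; exact Nat.one_le_iff_ne_zero.mpr (Nat.mul_ne_zero (by omega) (by omega))
  have hφle : φ ≤ ℓ ^ 2 := by
    rw [hφ, pow_two]; exact Nat.mul_le_mul_left _ (by omega)
  obtain ⟨ψ, hψ⟩ : ∃ ψ, φ = 2 * ψ := by
    have := Nat.even_mul_pred_self ℓ
    rw [← hφ] at this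
    obtain ⟨r, hr⟩ := this
    exact ⟨r, by omega⟩
  -- the discrete logs
  have hdl : ∀ p : {p // p ∈ S}, ∃ l : ℕ,
      (ℓ : ℤ) ^ v ∣ (((p : ℕ) ^ φ : ℕ) : ℤ) - (1 + (ℓ : ℤ) ^ 2) ^ l := by
    intro p
    apply exists_dlog
    have h1 : (p : ℕ) ^ φ ≡ 1 [MOD ℓ ^ 2] := by
      have h2 : Nat.totient (ℓ ^ 2) = φ := by
        rw [Nat.totient_prime_pow hℓ (by norm_num), hφ]; simp
      rw [← h2]
      exact Nat.ModEq.pow_totient (Nat.Coprime.pow_right 2 (hpl p p.2))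
    have h3 := (Nat.modEq_iff_dvd.mp h1.symm)
    exact_mod_cast h3
  choose l hl using hdl
  obtain ⟨p0, hp0⟩ : ∃ p, p ∈ S := by
    obtain ⟨p, hp1, hp2⟩ := Nat.exists_prime_and_dvd hne
    exact ⟨p, by rw [hSdef]; exact Nat.mem_primeFactors.mpr ⟨hp1, hp2, hxy0⟩⟩
  let e : {p // p ∈ S} → ℤ := fun p => (x.factorization p : ℤ) - y.factorization p
  have hbound : ∀ z p : ℕ, 2 ≤ p → z < 2 ^ D → z.factorization p ≤ D := by
    intro z p hp hzD
    exact Nat.factorization_le_of_le_pow (hzD.le.trans (Nat.pow_le_pow_left hp _))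
  have heD : ∀ p, |e p| ≤ D := by
    intro p
    have h1 := hbound x p (hSp p p.2).two_le hxD
    have h2 := hbound y p (hSp p p.2).two_le hyD
    simp only [e]
    rw [abs_le]; constructor <;> omega
  have he0 : e ⟨p0, hp0⟩ ≠ 0 := by
    have hpp := hSp p0 hp0
    have h1 : p0 ∣ x * y := by rw [hSdef] at hp0; exact Nat.dvd_of_mem_primeFactors hp0
    simp only [e]
    rcases (hpp.dvd_mul).mp h1 with h | h
    · have h2 : ¬ p0 ∣ y := fun h' => hpp.one_lt.ne' (Nat.dvd_one.mp (hxy ▸ Nat.dvd_gcd h h'))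
      rw [Nat.factorization_eq_zero_of_not_dvd h2]
      have := hpp.factorization_pos_of_dvd hx h
      omega
    · have h2 : ¬ p0 ∣ x := fun h' => hpp.one_lt.ne' (Nat.dvd_one.mp (hxy ▸ Nat.dvd_gcd h' h))
      rw [Nat.factorization_eq_zero_of_not_dvd h2]
      have := hpp.factorization_pos_of_dvd hy h
      omega
  obtain ⟨s, e', i0, hee, hi0⟩ := strip_val ℓ hℓ ⟨p0, hp0⟩ _ e he0 le_rfl
  have hs1 : (1 : ℤ) ≤ (ℓ : ℤ) ^ s := one_le_pow₀ (by exact_mod_cast hℓ.pos)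
  have hs : s ≤ 2 ^ (k - 5) := by
    have h1 : e' ⟨p0, hp0⟩ ≠ 0 := by intro h; apply he0; rw [hee, h, mul_zero]
    have h2 : (ℓ : ℤ) ^ s ≤ D := by
      refine le_trans ?_ (heD ⟨p0, hp0⟩)
      rw [hee, abs_mul, abs_of_nonneg (by positivity)]
      exact le_mul_of_one_le_right (by positivity) (Int.one_le_abs h1)
    have h3 : 2 ^ s ≤ 2 ^ 2 ^ (k - 5) :=
      le_trans (Nat.pow_le_pow_left hℓ2 _) (le_trans (by exact_mod_cast h2) hDk)
    exact (Nat.pow_le_pow_iff_right (by norm_num)).mp h3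
  have he'D : ∀ p, |e' p| ≤ D := by
    intro p
    refine le_trans ?_ (heD p)
    rw [hee, abs_mul, abs_of_nonneg (by positivity : (0 : ℤ) ≤ (ℓ : ℤ) ^ s)]
    exact le_mul_of_one_le_left (abs_nonneg _) hs1
  -- the relation
  have hrel : (ℓ : ℤ) ^ v ∣ (1 + (ℓ : ℤ) ^ 2) ^ (∑ p : {p // p ∈ S}, x.factorization p * l p) -
      (1 + (ℓ : ℤ) ^ 2) ^ (∑ p : {p // p ∈ S}, y.factorization p * l p) := by
    have h1 := Yc_congr ℓ v (fun p : {p // p ∈ S} => (p : ℕ) ^ φ) l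
      (fun p => x.factorization p) hl
    have h2 := Yc_congr ℓ v (fun p : {p // p ∈ S} => (p : ℕ) ^ φ) l
      (fun p => y.factorization p) hl
    rw [Yc_primes S φ x hx hSx] at h1
    rw [Yc_primes S φ y hy hSy] at h2
    have h3 : (ℓ : ℤ) ^ v ∣ ((x ^ φ : ℕ) : ℤ) - ((y ^ φ : ℕ) : ℤ) := by
      push_cast
      rw [hψ, pow_mul, pow_mul]
      exact hv.trans (sub_dvd_pow_sub_pow _ _ _)
    have h4 := dvd_add (dvd_sub h3 h1) h2
    refine h4.trans (dvd_of_eq (by ring))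
  obtain ⟨V0, hV0⟩ : ∃ V0, V0 = (2 * (2 ^ 60 * ℓ ^ 8)) ^ (5 * k) := ⟨_, rfl⟩
  rw [← hV0] at hcon
  have hV0big : 2 ^ (k - 5) + 2 ≤ V0 := by
    rw [hV0]
    have hk1 : 1 ≤ k := by
      by_contra h
      have : k = 0 := by omega
      rw [this] at hk2
      have hc : S.card ≠ 0 := Finset.card_ne_zero_of_mem hp0
      have h1 : 27 * (2 ^ 60 * ℓ ^ 8) ≤ 1 := le_trans (Nat.le_self_pow hc _) (by simpa using hk2)
      have : 0 < 2 ^ 60 * ℓ ^ 8 := by positivity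
      omega
    calc 2 ^ (k - 5) + 2 ≤ 2 ^ k + 2 ^ k := by
          refine Nat.add_le_add (Nat.pow_le_pow_right (by norm_num) (by omega)) ?_
          calc 2 = 2 ^ 1 := rfl
            _ ≤ 2 ^ k := Nat.pow_le_pow_right (by norm_num) hk1
      _ = 2 ^ (k + 1) := by ring
      _ ≤ 2 ^ (5 * k) := Nat.pow_le_pow_right (by norm_num) (by omega)
      _ ≤ _ := Nat.pow_le_pow_left (Nat.le_mul_of_pos_right _ (by positivity)) _
  have hord := gamma_order' ℓ (v - 2) _ _ (by
    have : v - 2 + 2 = v := by omega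
    rw [this]; exact hrel)
  have hrel2 : (ℓ : ℤ) ^ (v - 2 - s) ∣ ∑ p, e' p * (l p : ℤ) := by
    have h1 : ((∑ p : {p // p ∈ S}, x.factorization p * l p : ℕ) : ℤ) -
        ((∑ p : {p // p ∈ S}, y.factorization p * l p : ℕ) : ℤ) = (ℓ : ℤ) ^ s * ∑ p, e' p * (l p : ℤ) := by
      rw [Finset.mul_sum]
      push_cast
      rw [← Finset.sum_sub_distrib]
      refine Finset.sum_congr rfl (fun p _ => ?_)
      rw [← mul_assoc, ← hee]
      simp only [e]; ring
    rw [h1] at hord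
    have h2 : (ℓ : ℤ) ^ (v - 2) = (ℓ : ℤ) ^ s * (ℓ : ℤ) ^ (v - 2 - s) := by
      rw [← pow_add]; congr 1; omega
    rw [h2] at hord
    exact (mul_dvd_mul_iff_left (by positivity)).mp hord
  have hfin := thmG i0 (fun p : {p // p ∈ S} => (p : ℕ) ^ φ)
    (fun p => ℓ ^ 2 * (Nat.log 2 p + 1))
    (fun p => Nat.one_le_iff_ne_zero.mpr (by positivity))
    (fun p => by
      show (p : ℕ) ^ φ ≤ 2 ^ (ℓ ^ 2 * (Nat.log 2 p + 1))
      calc (p : ℕ) ^ φ ≤ (2 ^ (Nat.log 2 p + 1)) ^ φ :=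
            Nat.pow_le_pow_left (Nat.lt_pow_succ_log_self (by norm_num) _).le _
        _ = 2 ^ (φ * (Nat.log 2 p + 1)) := by rw [← pow_mul, mul_comm]
        _ ≤ _ := Nat.pow_le_pow_right (by norm_num) (Nat.mul_le_mul_right _ hφle))
    (fun p => Nat.one_le_pow _ _ (hSp p p.2).pos)
    (fun x y h => Yc_primes_inj S hSp φ hφ1 x y h) ℓ k (v - 2 - s) l
    (fun p => (pow_dvd_pow _ (by omega)).trans (hl p)) e' hi0 hrel2 D he'D hDk
    (by
      rw [Finset.prod_coe_sort S (fun p => 2 * (ℓ ^ 2 * (Nat.log 2 p + 1)))]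
      exact hk1)
    (by simpa using hk2)
  rw [← hV0] at hfin
  omega
end

end

section

section

lemma abc_val (ℓ : ℕ) (hℓ : ℓ.Prime) (a b c k D : ℕ) (ha : 0 < a) (hb : 0 < b)
    (hab : Nat.Coprime a b) (hac : Nat.Coprime a c) (hbc : Nat.Coprime b c) (habc : a + b = c)
    (hne : a * b ≠ 1) (hℓd : ℓ ∣ a * b * c) (hD : c < 2 ^ D) (hDk : D ≤ 2 ^ 2 ^ (k - 5))
    (hk1 : ∏ p ∈ (a * b * c).primeFactors, (2 * (ℓ ^ 2 * (Nat.log 2 p + 1))) ≤ 2 ^ k)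
    (hk2 : (27 * (2 ^ 60 * ℓ ^ 8)) ^ ((a * b * c).primeFactors.card) ≤ 2 ^ k) :
    (a * b * c).factorization ℓ < 2 * (2 * (2 ^ 60 * ℓ ^ 8)) ^ (5 * k) := by
  have hf : Fact ℓ.Prime := ⟨hℓ⟩
  have hc : 0 < c := by omega
  have h0 : a * b * c ≠ 0 := by positivity
  have hmono : ∀ z, z ∣ a * b * c →
      (∏ p ∈ z.primeFactors, (2 * (ℓ ^ 2 * (Nat.log 2 p + 1))) ≤ 2 ^ k) ∧
      ((27 * (2 ^ 60 * ℓ ^ 8)) ^ (z.primeFactors.card) ≤ 2 ^ k) := by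
    intro z hz
    have hsub := Nat.primeFactors_mono hz h0
    constructor
    · refine le_trans (Finset.prod_le_prod_of_subset_of_one_le' hsub (fun p _ _ => ?_)) hk1
      have : 0 < ℓ := hℓ.pos
      exact Nat.one_le_iff_ne_zero.mpr (by positivity)
    · refine le_trans (Nat.pow_le_pow_right ?_ (Finset.card_le_card hsub)) hk2
      have : 0 < ℓ := hℓ.pos
      positivity
  have hfac : (a * b * c).factorization ℓ =
      a.factorization ℓ + b.factorization ℓ + c.factorization ℓ := by
    rw [Nat.factorization_mul (by positivity) (by omega), Nat.factorization_mul (by omega) (by omega)]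
    simp
  have hz : ∀ z, ¬ ℓ ∣ z → z.factorization ℓ = 0 := fun z h =>
    Nat.factorization_eq_zero_of_not_dvd h
  have hcop : ∀ {s t : ℕ}, Nat.Coprime s t → ℓ ∣ s → ¬ ℓ ∣ t := fun h h1 h2 =>
    hℓ.one_lt.ne' (Nat.dvd_one.mp (h ▸ Nat.dvd_gcd h1 h2))
  have habc' : (a : ℤ) + b = c := by exact_mod_cast habc
  have hdv : ∀ z : ℕ, (ℓ : ℤ) ^ (z.factorization ℓ) ∣ (z : ℤ) := fun z => by
    exact_mod_cast Nat.ordProj_dvd z ℓ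
  rcases (hℓ.dvd_mul).mp hℓd with h | h
  · rcases (hℓ.dvd_mul).mp h with h | h
    · have n1 := hcop hab h
      have n2 := hcop hac h
      rw [hfac, hz b n1, hz c n2]
      obtain ⟨q1, q2⟩ := hmono (b * c) ⟨a, by ring⟩
      refine thmH ℓ b c _ k D (by omega) (by omega) hbc ?_ ?_ ?_ (by omega) hD hDk q1 q2
      · intro h; have := Nat.eq_one_of_mul_eq_one_left h; omega
      · intro h; exact ((hℓ.dvd_mul).mp h).elim n1 n2
      · refine (hdv a).trans ⟨-((b : ℤ) + c), ?_⟩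
        rw [← habc']; ring
    · have n1 := hcop hab.symm h
      have n2 := hcop hbc h
      rw [hfac, hz a n1, hz c n2]
      obtain ⟨q1, q2⟩ := hmono (a * c) ⟨b, by ring⟩
      rw [zero_add, add_zero]
      refine thmH ℓ a c _ k D (by omega) (by omega) hac ?_ ?_ ?_ (by omega) hD hDk q1 q2
      · intro h; have := Nat.eq_one_of_mul_eq_one_left h; omega
      · intro h; exact ((hℓ.dvd_mul).mp h).elim n1 n2
      · refine (hdv b).trans ⟨-((a : ℤ) + c), ?_⟩
        rw [← habc']; ring
  · have n1 := hcop hac.symm h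
    have n2 := hcop hbc.symm h
    rw [hfac, hz a n1, hz b n2]
    obtain ⟨q1, q2⟩ := hmono (a * b) ⟨c, by ring⟩
    rw [zero_add, zero_add]
    refine thmH ℓ a b _ k D (by omega) (by omega) hab hne ?_ ?_ (by omega) (by omega) hDk q1 q2
    · intro h; exact ((hℓ.dvd_mul).mp h).elim n1 n2
    · refine (hdv c).trans ⟨(a : ℤ) - b, ?_⟩
      rw [← habc']; ring

lemma log_succ_le (p : ℕ) (hp : 1 ≤ p) : Nat.log 2 p + 1 ≤ p := by
  have h1 : Nat.log 2 p < 2 ^ Nat.log 2 p := Nat.lt_two_pow_self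
  have h2 : 2 ^ Nat.log 2 p ≤ p := Nat.pow_log_le_self 2 (by omega)
  omega

set_option maxHeartbeats 1000000 in
lemma weak_bound (a b c : ℕ) (ha : 0 < a) (hb : 0 < b)
    (hab : Nat.Coprime a b) (hac : Nat.Coprime a c) (hbc : Nat.Coprime b c) (habc : a + b = c)
    (hne : a * b ≠ 1) (r : ℕ) (hr : r = Nat.log 2 (∏ p ∈ (a * b * c).primeFactors, p) + 1) :
    ∃ D q : ℕ, c < 2 ^ D ∧ D ≤ 2 ^ 2 ^ q ∧ 2 ^ q ≤ 4 * 54132 ^ 2 * r ^ 6 := by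
  have hc : 0 < c := by omega
  have h0 : a * b * c ≠ 0 := by positivity
  obtain ⟨S, hS⟩ : ∃ S, S = (a * b * c).primeFactors := ⟨_, rfl⟩
  obtain ⟨R, hR⟩ : ∃ R, R = ∏ p ∈ S, p := ⟨_, rfl⟩
  rw [← hS, ← hR] at hr
  have hSp : ∀ p ∈ S, p.Prime := fun p hp => by
    rw [hS] at hp; exact Nat.prime_of_mem_primeFactors hp
  have hR1 : 1 ≤ R := by
    rw [hR]; exact Finset.one_le_prod' (fun p hp => (hSp p hp).one_le)
  have hRr : R < 2 ^ r := by rw [hr]; exact Nat.lt_pow_succ_log_self (by norm_num) _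
  have hr1 : 1 ≤ r := by omega
  have hpR : ∀ p ∈ S, p ≤ R := fun p hp => by
    rw [hR]
    exact Finset.single_le_prod' (f := fun p => p) (fun q hq => (hSp q hq).one_le) hp
  have hn : S.card ≤ r := by
    have h1 : 2 ^ S.card ≤ R := by
      rw [hR]; exact Finset.pow_card_le_prod S (fun p => p) 2 (fun p hp => (hSp p hp).two_le)
    exact (Nat.pow_lt_pow_iff_right (by norm_num) |>.mp (h1.trans_lt hRr)).le
  obtain ⟨D, hD⟩ : ∃ D, D = Nat.log 2 c + 1 := ⟨_, rfl⟩
  have hcD : c < 2 ^ D := by rw [hD]; exact Nat.lt_pow_succ_log_self (by norm_num) _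
  have hex : ∃ q, D ≤ 2 ^ 2 ^ q := ⟨D, by
    have h1 : D ≤ 2 ^ D := Nat.lt_two_pow_self.le
    exact h1.trans (Nat.pow_le_pow_right (by norm_num) h1)⟩
  classical
  obtain ⟨q, hq⟩ : ∃ q, q = Nat.find hex := ⟨_, rfl⟩
  have hq1 : D ≤ 2 ^ 2 ^ q := hq ▸ Nat.find_spec hex
  refine ⟨D, q, hcD, hq1, ?_⟩
  obtain ⟨k, hk⟩ : ∃ k, k = 73 * r ^ 2 + 5 + q := ⟨_, rfl⟩
  -- valuations
  have hval : ∀ ℓ ∈ S, (a * b * c).factorization ℓ ≤ 2 ^ (346 * r * k) := by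
    intro ℓ hℓS
    have hℓ := hSp ℓ hℓS
    have hℓr : ℓ ≤ 2 ^ r := (hpR ℓ hℓS).trans hRr.le
    have h1 := abc_val ℓ hℓ a b c k D ha hb hab hac hbc habc hne
      (by rw [hS] at hℓS; exact Nat.dvd_of_mem_primeFactors hℓS) hcD
      (hq1.trans (Nat.pow_le_pow_right (by norm_num) (Nat.pow_le_pow_right (by norm_num)
        (by omega))))
      (by
        rw [← hS]
        calc ∏ p ∈ S, (2 * (ℓ ^ 2 * (Nat.log 2 p + 1)))
            ≤ ∏ p ∈ S, 2 ^ (3 * r + 1) := by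
              refine Finset.prod_le_prod' (fun p hp => ?_)
              calc 2 * (ℓ ^ 2 * (Nat.log 2 p + 1)) ≤ 2 * ((2 ^ r) ^ 2 * 2 ^ r) := by
                    gcongr
                    exact (log_succ_le p (hSp p hp).one_le).trans ((hpR p hp).trans hRr.le)
                _ = _ := by ring
          _ = 2 ^ ((3 * r + 1) * S.card) := by rw [Finset.prod_const, ← pow_mul]
          _ ≤ _ := by
              refine Nat.pow_le_pow_right (by norm_num) ?_
              rw [hk]; nlinarith)
      (by
        rw [← hS]
        calc (27 * (2 ^ 60 * ℓ ^ 8)) ^ S.card ≤ (2 ^ 5 * (2 ^ 60 * (2 ^ r) ^ 8)) ^ S.card := by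
              gcongr; norm_num
          _ = 2 ^ ((65 + 8 * r) * S.card) := by
              rw [pow_mul]; congr 1; ring
          _ ≤ _ := by
              refine Nat.pow_le_pow_right (by norm_num) ?_
              rw [hk]; nlinarith)
    refine h1.le.trans ?_
    calc 2 * (2 * (2 ^ 60 * ℓ ^ 8)) ^ (5 * k) ≤ 2 * (2 * (2 ^ 60 * (2 ^ r) ^ 8)) ^ (5 * k) := by
          gcongr
      _ = 2 ^ (1 + (61 + 8 * r) * (5 * k)) := by
          have e : 2 * (2 ^ 60 * (2 ^ r) ^ 8) = 2 ^ (61 + 8 * r) := by ring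
          rw [e, ← pow_mul, ← pow_succ']; congr 1; ring
      _ ≤ _ := by
          refine Nat.pow_le_pow_right (by norm_num) ?_
          have : 1 ≤ k := by omega
          nlinarith
  have hcR : c ≤ R ^ (2 ^ (346 * r * k)) := by
    have h1 : c ≤ a * b * c := Nat.le_mul_of_pos_left _ (by positivity)
    refine h1.trans ?_
    conv_lhs => rw [← Nat.prod_factorization_pow_eq_self h0]
    rw [Finsupp.prod, Nat.support_factorization, ← hS, hR, ← Finset.prod_pow]
    exact Finset.prod_le_prod' (fun p hp => Nat.pow_le_pow_right (hSp p hp).pos (hval p hp))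
  have hDle : D ≤ 2 ^ (347 * r * k) := by
    have hk1 : 1 ≤ k := by omega
    have h2 : c < 2 ^ (r * 2 ^ (346 * r * k)) := by
      refine hcR.trans_lt ?_
      rw [pow_mul 2 r]
      exact Nat.pow_lt_pow_left hRr (by positivity)
    have h3 : Nat.log 2 c < r * 2 ^ (346 * r * k) := Nat.log_lt_of_lt_pow (by omega) h2
    calc D ≤ r * 2 ^ (346 * r * k) := by omega
      _ ≤ 2 ^ r * 2 ^ (346 * r * k) := by gcongr; exact Nat.lt_two_pow_self.le
      _ = 2 ^ (r + 346 * r * k) := by rw [pow_add]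
      _ ≤ _ := by
          refine Nat.pow_le_pow_right (by norm_num) ?_
          nlinarith
  have hr6 : 1 ≤ r ^ 6 := Nat.one_le_pow _ _ hr1
  rcases Nat.eq_zero_or_pos q with hq0 | hqpos
  · rw [hq0]; omega
  · have h1 : ¬ D ≤ 2 ^ 2 ^ (q - 1) := Nat.find_min hex (by omega)
    push Not at h1
    have h2 : 2 ^ (q - 1) < 347 * r * k :=
      (Nat.pow_lt_pow_iff_right (by norm_num)).mp (h1.trans_le hDle)
    have h3 : 2 ^ q = 2 * 2 ^ (q - 1) := by rw [← pow_succ']; congr 1; omega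
    have h4 : k ≤ 78 * r ^ 2 * (q + 1) := by
      rw [hk]
      obtain ⟨t, ht⟩ : ∃ t, r ^ 2 = t + 1 := ⟨r ^ 2 - 1, by
        have : 1 ≤ r ^ 2 := Nat.one_le_pow _ _ hr1
        omega⟩
      rw [ht]
      have e : 78 * (t + 1) * (q + 1) = 78 * t * q + 78 * t + 78 * q + 78 := by ring
      have : 0 ≤ 78 * t * q := Nat.zero_le _
      omega
    have h5 : 2 ^ q ≤ 54132 * r ^ 3 * (q + 1) := by
      calc 2 ^ q ≤ 2 * (347 * r * (78 * r ^ 2 * (q + 1))) := by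
            rw [h3]
            refine Nat.mul_le_mul_left _ (h2.le.trans (Nat.mul_le_mul_left _ h4))
        _ = _ := by ring
    have h6 : (q + 1) ^ 2 ≤ 4 * 2 ^ q := by
      clear * -
      induction q with
      | zero => norm_num
      | succ q ih =>
        rcases Nat.lt_or_ge q 3 with h | h
        · interval_cases q <;> norm_num
        · rw [pow_succ 2 q]; nlinarith
    have h7 : 2 ^ q * 2 ^ q ≤ (4 * 54132 ^ 2 * r ^ 6) * 2 ^ q := by
      calc 2 ^ q * 2 ^ q ≤ (54132 * r ^ 3 * (q + 1)) * (54132 * r ^ 3 * (q + 1)) :=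
            Nat.mul_le_mul h5 h5
        _ = 54132 ^ 2 * r ^ 6 * (q + 1) ^ 2 := by ring
        _ ≤ 54132 ^ 2 * r ^ 6 * (4 * 2 ^ q) := by gcongr
        _ = _ := by ring
    exact Nat.le_of_mul_le_mul_right h7 (by positivity)

lemma nat_bound (a b c : ℕ) (ha : 0 < a) (hb : 0 < b)
    (hab : Nat.Coprime a b) (hac : Nat.Coprime a c) (hbc : Nat.Coprime b c) (habc : a + b = c)
    (hne : a * b ≠ 1) :
    (a * b * c).factorization 2 ≤ 2 * (64 * (4 * 54132 ^ 2 *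
      (Nat.log 2 (∏ p ∈ (a * b * c).primeFactors, p) + 1) ^ 6) *
      ∏ p ∈ (a * b * c).primeFactors, (2 ^ 76 * (Nat.log 2 p + 1))) ^ 345 := by
  by_cases h2 : 2 ∣ a * b * c
  swap
  · rw [Nat.factorization_eq_zero_of_not_dvd h2]; exact Nat.zero_le _
  obtain ⟨D, q, hcD, hDq, hq⟩ := weak_bound a b c ha hb hab hac hbc habc hne _ rfl
  obtain ⟨S, hS⟩ : ∃ S, S = (a * b * c).primeFactors := ⟨_, rfl⟩
  rw [← hS] at hq ⊢
  obtain ⟨r, hr⟩ : ∃ r, r = Nat.log 2 (∏ p ∈ S, p) + 1 := ⟨_, rfl⟩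
  rw [← hr] at hq ⊢
  obtain ⟨F, hF⟩ : ∃ F, F = ∏ p ∈ S, (2 ^ 76 * (Nat.log 2 p + 1)) := ⟨_, rfl⟩
  rw [← hF]
  have hF1 : 1 ≤ F := by
    rw [hF]; exact Finset.one_le_prod' (fun p _ => Nat.one_le_iff_ne_zero.mpr (by positivity))
  obtain ⟨Z, hZ⟩ : ∃ Z, Z = 32 * 2 ^ q * F := ⟨_, rfl⟩
  have hZ0 : Z ≠ 0 := by rw [hZ]; positivity
  obtain ⟨k, hk⟩ : ∃ k, k = Nat.log 2 Z + 1 := ⟨_, rfl⟩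
  have hZk : Z ≤ 2 ^ k := by rw [hk]; exact (Nat.lt_pow_succ_log_self (by norm_num) _).le
  have hkZ : 2 ^ k ≤ 2 * Z := by
    rw [hk, pow_succ, mul_comm]; gcongr; exact Nat.pow_log_le_self 2 hZ0
  have hFZ : F ≤ Z := by rw [hZ]; exact Nat.le_mul_of_pos_left _ (by positivity)
  have h32 : 2 ^ (q + 5) ≤ Z := by
    rw [hZ]
    calc 2 ^ (q + 5) = 32 * 2 ^ q := by ring
      _ ≤ _ := Nat.le_mul_of_pos_right _ (by omega)
  have hqk : q + 5 ≤ k := (Nat.pow_le_pow_iff_right (by norm_num)).mp (h32.trans hZk)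
  have hv := abc_val 2 Nat.prime_two a b c k D ha hb hab hac hbc habc hne h2 hcD
    (hDq.trans (Nat.pow_le_pow_right (by norm_num) (Nat.pow_le_pow_right (by norm_num)
        (by omega))))
    (by
      rw [← hS]
      refine le_trans ?_ (hFZ.trans hZk)
      rw [hF]
      refine Finset.prod_le_prod' (fun p _ => ?_)
      rw [← mul_assoc]
      gcongr
      norm_num)
    (by
      rw [← hS]
      refine le_trans ?_ (hFZ.trans hZk)
      rw [hF]
      refine Finset.pow_card_le_prod _ _ _ (fun p _ => ?_)
      refine le_trans ?_ (Nat.le_mul_of_pos_right _ (by omega))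
      norm_num)
  refine hv.le.trans (Nat.mul_le_mul_left _ ?_)
  have e : (2 * (2 ^ 60 * 2 ^ 8) : ℕ) = 2 ^ 69 := by norm_num
  rw [e, ← pow_mul]
  calc 2 ^ (69 * (5 * k)) = (2 ^ k) ^ 345 := by rw [← pow_mul]; congr 1; ring
    _ ≤ (2 * Z) ^ 345 := Nat.pow_le_pow_left hkZ _
    _ ≤ _ := by
        refine Nat.pow_le_pow_left ?_ _
        rw [hZ]
        calc 2 * (32 * 2 ^ q * F) = 64 * 2 ^ q * F := by ring
          _ ≤ _ := by gcongr
end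

end

section
open Filter

lemma log_small (K δ : ℝ) (hK : 0 < K) (hδ : 0 < δ) :
    ∃ N0 : ℕ, ∀ n : ℕ, N0 ≤ n → K * ((Nat.log 2 n : ℝ) + 1) ≤ (n : ℝ) ^ δ := by
  have h1 : (fun x : ℝ => Real.log x) =o[atTop] fun x => x ^ δ := isLittleO_log_rpow_atTop hδ
  have h2 := h1.bound (show 0 < 1 / (4 * K) by positivity)
  have h3 : ∀ᶠ x : ℝ in atTop, 2 * K ≤ x ^ δ :=
    (tendsto_rpow_atTop hδ).eventually_ge_atTop (2 * K)
  have h4 := (tendsto_natCast_atTop_atTop (R := ℝ)).eventually (h2.and h3)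
  obtain ⟨N0, hN0⟩ := eventually_atTop.mp h4
  refine ⟨max N0 1, fun n hn => ?_⟩
  obtain ⟨h5, h6⟩ := hN0 n (le_trans (le_max_left _ _) hn)
  have hn1 : 1 ≤ n := le_trans (le_max_right _ _) hn
  have hn0 : (0 : ℝ) < n := by exact_mod_cast hn1
  have hlog : (Nat.log 2 n : ℝ) ≤ 2 * Real.log n := by
    have h7 : (2 : ℝ) ^ (Nat.log 2 n) ≤ n := by exact_mod_cast Nat.pow_log_le_self 2 (by omega)
    have h8 := Real.log_le_log (by positivity) h7
    rw [Real.log_pow] at h8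
    have h9 := Real.log_two_gt_d9
    have : (0 : ℝ) ≤ Nat.log 2 n := by positivity
    nlinarith
  rw [Real.norm_eq_abs, Real.norm_eq_abs, abs_of_nonneg (Real.log_nonneg (by exact_mod_cast hn1)),
    abs_of_nonneg (by positivity)] at h5
  have h10 : 2 * K * Real.log n ≤ (n : ℝ) ^ δ / 2 := by
    calc 2 * K * Real.log n ≤ 2 * K * (1 / (4 * K) * (n : ℝ) ^ δ) := by gcongr
      _ = _ := by field_simp; ring
  nlinarith

lemma prod_small (δ : ℝ) (hδ : 0 < δ) : ∃ C : ℝ, 1 ≤ C ∧ ∀ S : Finset ℕ, (∀ p ∈ S, 1 ≤ p) →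
    ((∏ p ∈ S, (2 ^ 76 * (Nat.log 2 p + 1)) : ℕ) : ℝ) ≤ C * ((∏ p ∈ S, p : ℕ) : ℝ) ^ δ := by
  obtain ⟨N0, hN0⟩ := log_small (2 ^ 76) δ (by positivity) hδ
  let F : ℕ → ℝ := fun p => 2 ^ 76 * ((Nat.log 2 p : ℝ) + 1)
  have hF : ∀ p, 1 ≤ F p := fun p => by
    simp only [F]
    have : (0 : ℝ) ≤ Nat.log 2 p := by positivity
    nlinarith
  let G : ℕ → ℝ := fun p => if p < N0 then F p else 1
  have hG : ∀ p, 1 ≤ G p := fun p => by simp only [G]; split_ifs; exacts [hF p, le_rfl]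
  have hC : ∀ T : Finset ℕ, 1 ≤ ∏ p ∈ T, F p := fun T => by
    rw [← Finset.prod_const_one (s := T)]
    exact Finset.prod_le_prod (fun _ _ => zero_le_one) (fun p _ => hF p)
  refine ⟨∏ p ∈ Finset.range N0, F p, hC _, fun S hS => ?_⟩
  have h1 : ((∏ p ∈ S, (2 ^ 76 * (Nat.log 2 p + 1)) : ℕ) : ℝ) = ∏ p ∈ S, F p := by
    rw [Nat.cast_prod]
    refine Finset.prod_congr rfl (fun p _ => ?_)
    simp only [F]
    push_cast
    norm_num
  have h2 : ((∏ p ∈ S, p : ℕ) : ℝ) ^ δ = ∏ p ∈ S, (p : ℝ) ^ δ := by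
    push_cast
    rw [Real.finsetProd_rpow S _ (fun i _ => by positivity)]
  rw [h1, h2]
  have h3 : ∏ p ∈ S, F p ≤ ∏ p ∈ S, (G p * (p : ℝ) ^ δ) := by
    refine Finset.prod_le_prod (fun p _ => zero_le_one.trans (hF p)) (fun p hp => ?_)
    simp only [G]
    split_ifs with h
    · exact le_mul_of_one_le_right (zero_le_one.trans (hF p))
        (Real.one_le_rpow (by exact_mod_cast hS p hp) hδ.le)
    · rw [one_mul]; exact hN0 p (by omega)
  refine h3.trans ?_
  rw [Finset.prod_mul_distrib (f := G)]
  have h4 : ∏ p ∈ S, G p ≤ ∏ p ∈ Finset.range N0, F p := by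
    have h5 : ∏ p ∈ S, G p = ∏ p ∈ S.filter (· < N0), F p := by
      rw [Finset.prod_filter]
    rw [h5]
    have h6 : S.filter (· < N0) ⊆ Finset.range N0 := fun p hp => by
      simp only [Finset.mem_filter] at hp; simpa using hp.2
    rw [← Finset.prod_sdiff h6]
    exact le_mul_of_one_le_left (zero_le_one.trans (hC _)) (hC _)
  gcongr

lemma log_small' (δ : ℝ) (hδ : 0 < δ) : ∃ C : ℝ, 1 ≤ C ∧ ∀ n : ℕ, 1 ≤ n →
    ((Nat.log 2 n + 1 : ℕ) : ℝ) ≤ C * (n : ℝ) ^ δ := by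
  obtain ⟨N0, hN0⟩ := log_small 1 δ one_pos hδ
  refine ⟨N0 + 1, by simp, fun n hn => ?_⟩
  have h1 : (1 : ℝ) ≤ (n : ℝ) ^ δ := Real.one_le_rpow (by exact_mod_cast hn) hδ.le
  have hN : (0 : ℝ) ≤ N0 := by positivity
  rcases le_total N0 n with h | h
  · have := hN0 n h
    push_cast
    nlinarith
  · have h2 : ((Nat.log 2 n + 1 : ℕ) : ℝ) ≤ N0 := by
      exact_mod_cast (log_succ_le n hn).trans h
    nlinarith

end

theorem abc_two_adic_valuation_bound (ε : ℝ) (hε : 0 < ε) :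
    ∃ C : ℝ, 1 < C ∧ ∀ a b c : ℕ, 0 < a → 0 < b → 0 < c →
      Nat.Coprime a b → Nat.Coprime a c → Nat.Coprime b c → a + b = c →
      (((a * b * c).factorization 2 : ℕ) : ℝ) <
        C * ((∏ p ∈ (a * b * c).primeFactors, p : ℕ) : ℝ) ^ ε := by
  obtain ⟨δ, hδ⟩ : ∃ δ, δ = ε / 2415 := ⟨_, rfl⟩
  have hδ0 : 0 < δ := by rw [hδ]; positivity
  obtain ⟨C1, hC1, h1⟩ := log_small' δ hδ0
  obtain ⟨C2, hC2, h2⟩ := prod_small δ hδ0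
  obtain ⟨M, hM⟩ : ∃ M : ℝ, M = 2 * (64 * (4 * 54132 ^ 2 * C1 ^ 6) * C2) ^ 345 := ⟨_, rfl⟩
  have hM0 : 0 ≤ M := by rw [hM]; positivity
  refine ⟨M + 2, by linarith, fun a b c ha hb hc hab hac hbc habc => ?_⟩
  obtain ⟨R, hR⟩ : ∃ R, R = ∏ p ∈ (a * b * c).primeFactors, p := ⟨_, rfl⟩
  have hR1 : 1 ≤ R := by
    rw [hR]
    exact Finset.one_le_prod' (fun p hp => (Nat.prime_of_mem_primeFactors hp).one_le)
  have hRε : (1 : ℝ) ≤ (R : ℝ) ^ ε := Real.one_le_rpow (by exact_mod_cast hR1) hε.le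
  by_cases hne : a * b = 1
  · have ha1 : a = 1 := Nat.eq_one_of_mul_eq_one_right hne
    have hb1 : b = 1 := Nat.eq_one_of_mul_eq_one_left hne
    rw [← hR]
    have : (a * b * c).factorization 2 = 1 := by
      have : a * b * c = 2 := by subst ha1 hb1 habc; norm_num
      rw [this]; exact Nat.prime_two.factorization_self
    rw [this]
    push_cast
    nlinarith
  · have h3 := nat_bound a b c ha hb hab hac hbc habc hne
    have h4 := h2 (a * b * c).primeFactors
      (fun p hp => (Nat.prime_of_mem_primeFactors hp).one_le)
    rw [← hR] at h3 h4 ⊢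
    have h5 := h1 R hR1
    obtain ⟨F, hF⟩ : ∃ F, F = ∏ p ∈ (a * b * c).primeFactors, (2 ^ 76 * (Nat.log 2 p + 1)) :=
      ⟨_, rfl⟩
    rw [← hF] at h3 h4
    obtain ⟨r, hr⟩ : ∃ r, r = Nat.log 2 R + 1 := ⟨_, rfl⟩
    rw [← hr] at h3 h5
    have h6 : (((a * b * c).factorization 2 : ℕ) : ℝ) ≤
        2 * (64 * (4 * 54132 ^ 2 * (r : ℝ) ^ 6) * F) ^ 345 := by exact_mod_cast h3
    obtain ⟨w, hw⟩ : ∃ w : ℝ, w = (R : ℝ) ^ δ := ⟨_, rfl⟩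
    rw [← hw] at h4 h5
    have hw0 : 0 ≤ w := by rw [hw]; positivity
    have hwε : w ^ 2415 = (R : ℝ) ^ ε := by
      rw [hw, ← Real.rpow_natCast, ← Real.rpow_mul (by positivity), hδ]
      congr 1
      push_cast
      field_simp
    have h7 : 2 * (64 * (4 * 54132 ^ 2 * (r : ℝ) ^ 6) * F) ^ 345 ≤ M * w ^ 2415 := by
      calc 2 * (64 * (4 * 54132 ^ 2 * (r : ℝ) ^ 6) * F) ^ 345
          ≤ 2 * (64 * (4 * 54132 ^ 2 * (C1 * w) ^ 6) * (C2 * w)) ^ 345 := by gcongr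
        _ = 2 * ((64 * (4 * 54132 ^ 2 * C1 ^ 6) * C2) * w ^ 7) ^ 345 := by congr 2; ring
        _ = _ := by rw [mul_pow _ (w ^ 7), ← pow_mul, hM, ← mul_assoc]
    rw [hwε] at h7
    nlinarith
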